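/- arXiv:1908.08245 — 2 statements merged into one kernel-verified Lean document; each statement's English description precedes it below -/
import Mathlib

section
/- Suppose Assumptions (A1.a), (A1.b), (A3.a), (A3.b) and (A4) hold, that sup_{l≥1} ‖𝒜_l‖ < ∞ and sup_{l≥1} ‖ℋ_l‖ < ∞, and that: (c.1) the stationary weighted adjacency matrix Σ_{l≥1} π_l 𝒜_l is entrywise nonnegative, balanced (its i-th row sum equals its i-th column sum for every i), and the digraph on {1,…,N} having an edge from j to i whenever the (i,j) entry of Σ_{l≥1} π_l 𝒜_l is positive contains a spanning tree; (c.2) the measurement model is spatially-temporally jointly observable, i.e. the matrix Σ_{i=1}^N Σ_{l≥1} π_l H_{i,l}ᵀ H_{i,l} is positive definite. Then the delay-free distributed estimation algorithm converges in mean square and almost surely: for every node i = 1,…,N, lim_{k→∞} E‖x_i(k) − x_0‖² = 0 and x_i(k) → x_0 a.s. -/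
open MeasureTheory Filter Matrix Topology
open scoped Kronecker

/-- Spectral (2-)norm of a real matrix. -/
noncomputable def specNorm {p q : Type*} [Fintype p] [Fintype q] [DecidableEq q]
    (A : Matrix p q ℝ) : ℝ :=
  ‖LinearMap.toContinuousLinearMap (Matrix.toEuclideanLin A)‖

/-- The block diagonal matrix `ℋ = blockdiag(H_1, …, H_N)` of the observation matrices. -/
def blockH {N n : ℕ} {ni : Fin N → ℕ}
    (H : ∀ i : Fin N, Matrix (Fin (ni i)) (Fin n) ℝ) :
    Matrix (Σ i : Fin N, Fin (ni i)) (Fin N × Fin n) ℝ :=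
  Matrix.of fun r c => if r.1 = c.1 then H r.1 r.2 c.2 else 0

/-- The σ-field `ℱ(k-1) = σ(𝒜(s), v(s), H_i(s) : 1 ≤ i ≤ N, 0 ≤ s ≤ k-1)`,
generated by the randomness strictly before time `k` (trivial for `k = 0`). -/
def sigBefore {Ω : Type*} {N n : ℕ} {ni : Fin N → ℕ}
    (H : ℕ → ∀ i : Fin N, Ω → Matrix (Fin (ni i)) (Fin n) ℝ)
    (v : ℕ → Ω → ∀ i : Fin N, Fin (ni i) → ℝ)
    (A : ℕ → Ω → Matrix (Fin N) (Fin N) ℝ) (k : ℕ) : MeasurableSpace Ω :=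
  ⨆ s, ⨆ _ : s < k,
    MeasurableSpace.comap
        (fun ω (i : Fin N) (p : Fin (ni i)) (c : Fin n) => H s i ω p c) inferInstance
    ⊔ MeasurableSpace.comap (v s) inferInstance
    ⊔ MeasurableSpace.comap (fun ω (i j : Fin N) => A s ω i j) inferInstance

/-- The partial products of `1 + γ j` for a summable nonnegative `γ` are bounded. -/
lemma prod_one_add_le_exp_tsum {γ : ℕ → ℝ} (hγ : ∀ k, 0 ≤ γ k) (hγs : Summable γ) (k : ℕ) :
    ∏ j ∈ Finset.range k, (1 + γ j) ≤ Real.exp (∑' j, γ j) := by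
  calc ∏ j ∈ Finset.range k, (1 + γ j) ≤ ∏ j ∈ Finset.range k, Real.exp (γ j) :=
        Finset.prod_le_prod (fun j _ => by linarith [hγ j])
          fun j _ => by linarith [Real.add_one_le_exp (γ j)]
    _ = Real.exp (∑ j ∈ Finset.range k, γ j) := (Real.exp_sum _ _).symm
    _ ≤ _ := Real.exp_le_exp.2 (hγs.sum_le_tsum _ fun j _ => hγ j)

lemma one_le_prod_one_add {γ : ℕ → ℝ} (hγ : ∀ k, 0 ≤ γ k) (k : ℕ) :
    1 ≤ ∏ j ∈ Finset.range k, (1 + γ j) := by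
  induction k with
  | zero => simp
  | succ k ih =>
    rw [Finset.prod_range_succ]
    nlinarith [hγ k]

/-- A nonnegative sequence which, up to summable perturbations, contracts by factors
`1 - α k` with divergent `∑ α k`, tends to zero. -/
lemma tendsto_zero_of_perturbed_contraction {w α γ η : ℕ → ℝ} (hw : ∀ k, 0 ≤ w k)
    (hα : ∀ k, 0 ≤ α k) (hγ : ∀ k, 0 ≤ γ k) (hη : ∀ k, 0 ≤ η k)
    (hγs : Summable γ) (hηs : Summable η)
    (hαd : Tendsto (fun K => ∑ k ∈ Finset.range K, α k) atTop atTop)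
    (hstep : ∀ k, w (k + 1) ≤ (1 + γ k - α k) * w k + η k) :
    Tendsto w atTop (𝓝 0) := by
  set p : ℕ → ℝ := fun k => ∏ j ∈ Finset.range k, (1 + γ j) with hp
  set B := Real.exp (∑' j, γ j) with hB
  have hBpos : 0 < B := Real.exp_pos _
  have hpB : ∀ k, p k ≤ B := prod_one_add_le_exp_tsum hγ hγs
  have hp1 : ∀ k, 1 ≤ p k := one_le_prod_one_add hγ
  have hppos : ∀ k, 0 < p k := fun k => zero_lt_one.trans_le (hp1 k)
  have hpsucc : ∀ k, p (k + 1) = p k * (1 + γ k) := fun k => Finset.prod_range_succ _ _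
  set u : ℕ → ℝ := fun k => w k / p k with hu
  have hu0 : ∀ k, 0 ≤ u k := fun k => div_nonneg (hw k) (hppos k).le
  have hwu : ∀ k, w k = p k * u k := fun k => by
    simp only [hu]; field_simp [(hppos k).ne']
  have hustep : ∀ k, u (k + 1) ≤ u k - α k / B * u k + η k := by
    intro k
    have h1 : u (k + 1) ≤ ((1 + γ k - α k) * w k + η k) / p (k + 1) :=
      div_le_div_of_nonneg_right (hstep k) (hppos _).le
    have h2 : ((1 + γ k - α k) * w k + η k) / p (k + 1)
        = u k - α k * w k / p (k + 1) + η k / p (k + 1) := by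
      rw [hwu k, hpsucc k]
      have := (hppos k).ne'
      have h3 : (1 + γ k) ≠ 0 := by linarith [hγ k]
      field_simp
    have h3 : η k / p (k + 1) ≤ η k := div_le_self (hη k) (hp1 _)
    have h4 : α k / B * u k ≤ α k * w k / p (k + 1) := by
      rw [div_mul_eq_mul_div]
      have h5 : u k ≤ w k := div_le_self (hw k) (hp1 _)
      exact div_le_div₀ (mul_nonneg (hα k) (hw k)) (mul_le_mul_of_nonneg_left h5 (hα k))
        (hppos _) (hpB _)
    linarith
  have hsum_le : ∀ k, ∑ j ∈ Finset.range k, η j ≤ ∑' j, η j :=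
    fun k => hηs.sum_le_tsum _ fun j _ => hη j
  have hanti : Antitone fun k => u k - ∑ j ∈ Finset.range k, η j := by
    refine antitone_nat_of_succ_le fun k => ?_
    rw [Finset.sum_range_succ]
    have := mul_nonneg (div_nonneg (hα k) hBpos.le) (hu0 k)
    linarith [hustep k]
  obtain ⟨z, hz⟩ : ∃ z, Tendsto (fun k => u k - ∑ j ∈ Finset.range k, η j) atTop (𝓝 z) := by
    refine ⟨_, tendsto_atTop_ciInf hanti ⟨-∑' j, η j, ?_⟩⟩
    rintro _ ⟨k, rfl⟩
    have := hu0 k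
    have := hsum_le k
    simp only
    linarith
  have hul : Tendsto u atTop (𝓝 (z + ∑' j, η j)) := by
    have := hz.add hηs.hasSum.tendsto_sum_nat
    simpa using this
  set L := z + ∑' j, η j
  have hL0 : 0 ≤ L := ge_of_tendsto' hul hu0
  have hL : L = 0 := by
    by_contra hne
    have hLpos : 0 < L := lt_of_le_of_ne hL0 (Ne.symm hne)
    obtain ⟨K, hK⟩ := eventually_atTop.1 (hul.eventually (lt_mem_nhds (half_lt_self hLpos)))
    have hbd : ∀ M, u (M) + ∑ k ∈ Finset.range M, α k / B * u k ≤
        u 0 + ∑ j ∈ Finset.range M, η j := by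
      intro M
      induction M with
      | zero => simp
      | succ M ih =>
        rw [Finset.sum_range_succ, Finset.sum_range_succ]
        linarith [hustep M]
    have hlow : ∀ M, (∑ k ∈ Finset.range M, α k - ∑ k ∈ Finset.range K, α k) * (L / 2 / B) ≤
        ∑ k ∈ Finset.range M, α k / B * u k := by
      intro M
      rw [sub_mul, Finset.sum_mul, Finset.sum_mul, sub_le_iff_le_add]
      rcases le_total M K with h | h
      · have h1 : ∑ k ∈ Finset.range M, α k * (L / 2 / B) ≤
            ∑ k ∈ Finset.range K, α k * (L / 2 / B) :=
          Finset.sum_le_sum_of_subset_of_nonneg (Finset.range_mono h)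
            fun i _ _ => mul_nonneg (hα i) (by positivity)
        have h2 : 0 ≤ ∑ k ∈ Finset.range M, α k / B * u k :=
          Finset.sum_nonneg fun i _ => mul_nonneg (div_nonneg (hα i) hBpos.le) (hu0 i)
        linarith
      · rw [← Finset.sum_range_add_sum_Ico _ h, ← Finset.sum_range_add_sum_Ico _ h]
        have h2 : 0 ≤ ∑ k ∈ Finset.range K, α k / B * u k :=
          Finset.sum_nonneg fun i _ => mul_nonneg (div_nonneg (hα i) hBpos.le) (hu0 i)
        have h3 : ∑ k ∈ Finset.Ico K M, α k * (L / 2 / B) ≤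
            ∑ k ∈ Finset.Ico K M, α k / B * u k := by
          refine Finset.sum_le_sum fun i hi => ?_
          have := hK i (Finset.mem_Ico.1 hi).1
          calc α i * (L / 2 / B) = α i / B * (L / 2) := by ring
            _ ≤ _ := mul_le_mul_of_nonneg_left this.le (div_nonneg (hα i) hBpos.le)
        linarith
    have ht : Tendsto (fun M => (∑ k ∈ Finset.range M, α k - ∑ k ∈ Finset.range K, α k)
        * (L / 2 / B)) atTop atTop :=
      (tendsto_atTop_add_const_right _ _ hαd).atTop_mul_const (by positivity)
    obtain ⟨M, hM⟩ := (ht.eventually_gt_atTop (u 0 + ∑' j, η j)).exists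
    linarith [hlow M, hbd M, hu0 M, hsum_le M]
  rw [hL] at hul
  have hBu : Tendsto (fun k => B * u k) atTop (𝓝 0) := by simpa using hul.const_mul B
  exact squeeze_zero hw (fun k => (hwu k).le.trans
    (mul_le_mul_of_nonneg_right (hpB k) (hu0 k))) hBu

/-- **Robbins–Siegmund type lemma.** A nonnegative adapted process whose conditional drift is,
up to summable perturbations, a contraction by factors `1 - α k` with divergent `∑ α k`,
tends to zero in mean and almost surely. -/
theorem tendsto_zero_of_condExp_contraction {Ω : Type*} {m0 : MeasurableSpace Ω}
    {μ : Measure Ω} [IsProbabilityMeasure μ] (ℱ : Filtration ℕ m0) {W : ℕ → Ω → ℝ}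
    {α γ η : ℕ → ℝ} (hadp : ∀ k, StronglyMeasurable[ℱ k] (W k))
    (hInt : ∀ k, Integrable (W k) μ) (hW : ∀ k, 0 ≤ᵐ[μ] W k)
    (hα : ∀ k, 0 ≤ α k) (hγ : ∀ k, 0 ≤ γ k) (hη : ∀ k, 0 ≤ η k)
    (hγs : Summable γ) (hηs : Summable η)
    (hαd : Tendsto (fun K => ∑ k ∈ Finset.range K, α k) atTop atTop)
    (hstep : ∀ k, μ[W (k + 1)|ℱ k] ≤ᵐ[μ] fun ω => (1 + γ k - α k) * W k ω + η k) :
    Tendsto (fun k => ∫ ω, W k ω ∂μ) atTop (𝓝 0) ∧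
      ∀ᵐ ω ∂μ, Tendsto (fun k => W k ω) atTop (𝓝 0) := by
  have hmean : Tendsto (fun k => ∫ ω, W k ω ∂μ) atTop (𝓝 0) := by
    refine tendsto_zero_of_perturbed_contraction (fun k => integral_nonneg_of_ae (hW k))
      hα hγ hη hγs hηs hαd fun k => ?_
    calc ∫ ω, W (k + 1) ω ∂μ = ∫ ω, (μ[W (k + 1)|ℱ k]) ω ∂μ := (integral_condExp (ℱ.le k)).symm
      _ ≤ ∫ ω, ((1 + γ k - α k) * W k ω + η k) ∂μ :=
          integral_mono_ae integrable_condExp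
            (((hInt k).const_mul _).add (integrable_const _)) (hstep k)
      _ = _ := by
          rw [integral_add ((hInt k).const_mul _) (integrable_const _), integral_const_mul]
          simp
  refine ⟨hmean, ?_⟩
  set p : ℕ → ℝ := fun k => ∏ j ∈ Finset.range k, (1 + γ j) with hp
  have hp1 : ∀ k, 1 ≤ p k := one_le_prod_one_add hγ
  have hppos : ∀ k, 0 < p k := fun k => zero_lt_one.trans_le (hp1 k)
  have hpsucc : ∀ k, p (k + 1) = p k * (1 + γ k) := fun k => Finset.prod_range_succ _ _
  set Y : ℕ → Ω → ℝ := fun k ω => (p k)⁻¹ * W k ω - ∑ j ∈ Finset.range k, η j with hY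
  have hYint : ∀ k, Integrable (Y k) μ := fun k =>
    ((hInt k).const_mul _).sub (integrable_const _)
  have hsuper : Supermartingale Y ℱ μ := by
    refine supermartingale_nat (fun k => ((hadp k).const_mul _).sub stronglyMeasurable_const)
      hYint fun k => ?_
    have h1 : μ[Y (k + 1)|ℱ k] =ᵐ[μ] fun ω => (p (k + 1))⁻¹ * (μ[W (k + 1)|ℱ k]) ω
        - ∑ j ∈ Finset.range (k + 1), η j := by
      have h2 : Y (k + 1) = (p (k + 1))⁻¹ • W (k + 1)
          - fun _ => ∑ j ∈ Finset.range (k + 1), η j := by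
        ext ω; simp [hY]
      rw [h2]
      refine (condExp_sub ((hInt _).smul _) (integrable_const _) _).trans ?_
      filter_upwards [condExp_smul (p (k + 1))⁻¹ (W (k + 1)) (μ := μ) (ℱ k)] with ω hω
      simp [hω, condExp_const (ℱ.le k)]
    filter_upwards [h1, hstep k, hW k] with ω h1 h2 h3
    rw [h1]
    simp only [Pi.zero_apply] at h3
    have h4 : (p (k + 1))⁻¹ * (μ[W (k + 1)|ℱ k]) ω ≤ (p k)⁻¹ * W k ω + η k := by
      calc (p (k + 1))⁻¹ * (μ[W (k + 1)|ℱ k]) ω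
          ≤ (p (k + 1))⁻¹ * ((1 + γ k) * W k ω + η k) := by
            refine mul_le_mul_of_nonneg_left (h2.trans ?_) (inv_nonneg.2 (hppos _).le)
            nlinarith [mul_nonneg (hα k) h3]
        _ = (p k)⁻¹ * W k ω + (p (k + 1))⁻¹ * η k := by
            rw [hpsucc k]
            have := (hppos k).ne'
            have h3 : (1 + γ k) ≠ 0 := by linarith [hγ k]
            field_simp
        _ ≤ _ := by
            have := mul_le_mul_of_nonneg_right (inv_le_one_of_one_le₀ (hp1 (k + 1))) (hη k)
            linarith
    simp only [hY]
    rw [Finset.sum_range_succ]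
    linarith
  obtain ⟨C, hC⟩ := hmean.bddAbove_range
  have hsum_le : ∀ k, ∑ j ∈ Finset.range k, η j ≤ ∑' j, η j :=
    fun k => hηs.sum_le_tsum _ fun j _ => hη j
  have hbdd : ∀ k, eLpNorm ((-Y) k) 1 μ ≤ ((C + ∑' j, η j).toNNReal : ENNReal) := by
    intro k
    rw [Pi.neg_apply, eLpNorm_neg, eLpNorm_one_eq_lintegral_enorm,
      ← ofReal_integral_norm_eq_lintegral_enorm (hYint k)]
    refine ENNReal.ofReal_le_ofReal ?_
    calc ∫ ω, ‖Y k ω‖ ∂μ ≤ ∫ ω, (W k ω + ∑' j, η j) ∂μ := by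
          refine integral_mono_ae (hYint k).norm ((hInt k).add (integrable_const _)) ?_
          filter_upwards [hW k] with ω h3
          simp only [Pi.zero_apply] at h3
          have h4 : (p k)⁻¹ * W k ω ≤ W k ω :=
            mul_le_of_le_one_left h3 (inv_le_one_of_one_le₀ (hp1 k))
          have h5 : 0 ≤ (p k)⁻¹ * W k ω := mul_nonneg (inv_nonneg.2 (hppos _).le) h3
          have h6 : 0 ≤ ∑ j ∈ Finset.range k, η j := Finset.sum_nonneg fun j _ => hη j
          simp only [hY, Real.norm_eq_abs]
          rw [abs_le]
          constructor <;> linarith [hsum_le k]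
      _ = (∫ ω, W k ω ∂μ) + ∑' j, η j := by
          rw [integral_add (hInt k) (integrable_const _)]; simp
      _ ≤ _ := by linarith [hC (Set.mem_range_self k)]
  have hconv := hsuper.neg.exists_ae_tendsto_of_bdd hbdd
  have hmeas : TendstoInMeasure μ W atTop (0 : Ω → ℝ) := by
    refine tendstoInMeasure_of_tendsto_eLpNorm one_ne_zero (fun k => (hInt k).1)
      aestronglyMeasurable_zero ?_
    have h1 : ∀ k, eLpNorm (W k - 0) 1 μ = ENNReal.ofReal (∫ ω, W k ω ∂μ) := by
      intro k
      rw [sub_zero, eLpNorm_one_eq_lintegral_enorm,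
        ← ofReal_integral_norm_eq_lintegral_enorm (hInt k)]
      congr 1
      refine integral_congr_ae ?_
      filter_upwards [hW k] with ω h3
      exact abs_of_nonneg h3
    simp_rw [h1]
    simpa using ENNReal.tendsto_ofReal hmean
  obtain ⟨ns, hns, hae⟩ := hmeas.exists_seq_tendsto_ae
  filter_upwards [hconv, hae, ae_all_iff.2 hW] with ω ⟨c, hc⟩ hsub hWω
  have hu : Tendsto (fun k => (p k)⁻¹ * W k ω) atTop (𝓝 (-c + ∑' j, η j)) := by
    have := hc.neg.add hηs.hasSum.tendsto_sum_nat
    simpa [hY] using this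
  have hu0 : Tendsto (fun i => (p (ns i))⁻¹ * W (ns i) ω) atTop (𝓝 0) :=
    squeeze_zero (fun i => mul_nonneg (inv_nonneg.2 (hppos _).le) (hWω _))
      (fun i => mul_le_of_le_one_left (hWω _) (inv_le_one_of_one_le₀ (hp1 _))) hsub
  rw [tendsto_nhds_unique (hu.comp hns.tendsto_atTop) hu0] at hu
  have hBu : Tendsto (fun k => Real.exp (∑' j, γ j) * ((p k)⁻¹ * W k ω)) atTop (𝓝 0) := by
    simpa using hu.const_mul (Real.exp (∑' j, γ j))
  refine squeeze_zero hWω (fun k => ?_) hBu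
  calc W k ω = p k * ((p k)⁻¹ * W k ω) := by
        rw [mul_inv_cancel_left₀ (hppos k).ne']
    _ ≤ _ := mul_le_mul_of_nonneg_right (prod_one_add_le_exp_tsum hγ hγs k)
        (mul_nonneg (inv_nonneg.2 (hppos _).le) (hWω k))

section QuadraticForms

variable {ι : Type*} [Fintype ι]

lemma dotProduct_self_nonneg' (u : ι → ℝ) : 0 ≤ u ⬝ᵥ u :=
  Finset.sum_nonneg fun i _ => mul_self_nonneg (u i)

/-- A weighted Young inequality for bilinear forms with entries bounded by `c * t`. -/
lemma abs_dotProduct_mulVec_le {M : Matrix ι ι ℝ} {c t : ℝ} (hc : 0 ≤ c)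
    (hM : ∀ i j, |M i j| ≤ c * t) (u v : ι → ℝ) :
    |u ⬝ᵥ M *ᵥ v| ≤ c * Fintype.card ι * (t ^ 2 * (u ⬝ᵥ u) + v ⬝ᵥ v) := by
  have hterm : ∀ i j, |u i * (M i j * v j)| ≤ c * (t ^ 2 * (u i * u i) + v j * v j) := by
    intro i j
    rw [abs_mul, abs_mul]
    have h1 : |u i| * (|M i j| * |v j|) ≤ |u i| * ((c * t) * |v j|) := by
      gcongr; exact hM i j
    have h2 : t * |u i| * |v j| ≤ t ^ 2 * (u i * u i) + v j * v j := by
      have h3 := abs_mul_abs_self (u i)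
      have h4 := abs_mul_abs_self (v j)
      nlinarith [sq_nonneg (t * |u i| - |v j|), sq_nonneg (t * |u i|), sq_nonneg (|v j|)]
    nlinarith [mul_le_mul_of_nonneg_left h2 hc]
  calc |u ⬝ᵥ M *ᵥ v| = |∑ i, ∑ j, u i * (M i j * v j)| := by
        simp [dotProduct, mulVec, Finset.mul_sum]
    _ ≤ ∑ i, ∑ j, |u i * (M i j * v j)| :=
        (Finset.abs_sum_le_sum_abs _ _).trans
          (Finset.sum_le_sum fun i _ => Finset.abs_sum_le_sum_abs _ _)
    _ ≤ ∑ i, ∑ j, c * (t ^ 2 * (u i * u i) + v j * v j) :=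
        Finset.sum_le_sum fun i _ => Finset.sum_le_sum fun j _ => hterm i j
    _ = _ := by
        simp only [dotProduct, ← Finset.mul_sum, Finset.sum_add_distrib, Finset.sum_const,
          Finset.card_univ, nsmul_eq_mul, mul_left_comm _ (Fintype.card ι : ℝ)]
        ring

lemma mulVec_dotProduct_mulVec_le {M : Matrix ι ι ℝ} {c : ℝ}
    (hM : ∀ i j, |M i j| ≤ c) (u : ι → ℝ) :
    (M *ᵥ u) ⬝ᵥ (M *ᵥ u) ≤ (Fintype.card ι : ℝ) ^ 2 * c ^ 2 * (u ⬝ᵥ u) := by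
  have h1 : ∀ i, (M *ᵥ u) i * (M *ᵥ u) i ≤ Fintype.card ι * c ^ 2 * (u ⬝ᵥ u) := by
    intro i
    have h2 := Finset.sum_mul_sq_le_sq_mul_sq Finset.univ (fun j => M i j) u
    have h3 : ∑ j, M i j ^ 2 ≤ Fintype.card ι * c ^ 2 := by
      calc ∑ j, M i j ^ 2 ≤ ∑ _j : ι, c ^ 2 := Finset.sum_le_sum fun j _ => by
            rw [← sq_abs]; exact pow_le_pow_left₀ (abs_nonneg _) (hM i j) 2
        _ = _ := by simp
    have h4 : ∑ j, u j ^ 2 = u ⬝ᵥ u := by simp [dotProduct, sq]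
    rw [h4] at h2
    calc (M *ᵥ u) i * (M *ᵥ u) i = (∑ j, M i j * u j) ^ 2 := by
          simp [mulVec, dotProduct, sq]
      _ ≤ _ := h2.trans (mul_le_mul_of_nonneg_right h3 (dotProduct_self_nonneg' u))
  calc (M *ᵥ u) ⬝ᵥ (M *ᵥ u) ≤ ∑ _i : ι, Fintype.card ι * c ^ 2 * (u ⬝ᵥ u) :=
        Finset.sum_le_sum fun i _ => h1 i
    _ = _ := by
        simp only [Finset.sum_const, Finset.card_univ, nsmul_eq_mul]; ring

/-- One-step estimate for the perturbed quadratic Lyapunov function `e ⬝ e - 2 e ⬝ Q e` along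
`e ↦ e - G e + w`, when `G` splits into a mean part `Gm`, a fluctuation `F`, an increment
`Q - Q'` of the corrector, and a remainder bounded by `δ`. -/
lemma perturbed_lyapunov_step {G Gm F Q Q' : Matrix ι ι ℝ} {C b b₀ δ : ℝ} (hC : 0 ≤ C)
    (hb : 0 ≤ b) (hbb : b ≤ b₀) (hδ : 0 ≤ δ) (hG : ∀ i j, |G i j| ≤ C * b)
    (hQ' : ∀ i j, |Q' i j| ≤ C * b) (hΔ : ∀ i j, |(G - (Gm + F + Q - Q')) i j| ≤ δ)
    (e w e' : ι → ℝ) (he' : e' = e - G *ᵥ e + w) :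
    e' ⬝ᵥ e' - 2 * (e' ⬝ᵥ Q' *ᵥ e') ≤ e ⬝ᵥ e - 2 * (e ⬝ᵥ Q *ᵥ e) - 2 * (e ⬝ᵥ Gm *ᵥ e)
      + (2 * (e ⬝ᵥ w) - 2 * (e ⬝ᵥ F *ᵥ e))
      + (4 * Fintype.card ι * δ + (4 * C * Fintype.card ι +
          2 * (1 + 4 * C * Fintype.card ι + 4 * C * b₀ * Fintype.card ι)
            * (Fintype.card ι ^ 2 * C ^ 2)) * b ^ 2) * (e ⬝ᵥ e)
      + 2 * (1 + 4 * C * Fintype.card ι + 4 * C * b₀ * Fintype.card ι) * (w ⬝ᵥ w) := by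
  set m : ℝ := (Fintype.card ι : ℝ) with hm
  have hm0 : 0 ≤ m := Nat.cast_nonneg _
  set d : ι → ℝ := -(G *ᵥ e) + w with hd
  have hed : e' = e + d := by rw [he', hd]; abel
  set Δ := G - (Gm + F + Q - Q') with hΔdef
  have hGe : G *ᵥ e = Gm *ᵥ e + F *ᵥ e + Q *ᵥ e - Q' *ᵥ e + Δ *ᵥ e := by
    have : G = Gm + F + Q - Q' + Δ := by rw [hΔdef]; abel
    conv_lhs => rw [this]
    simp only [add_mulVec, sub_mulVec]
  have h1 : |e ⬝ᵥ Δ *ᵥ e| ≤ δ * m * (1 ^ 2 * (e ⬝ᵥ e) + e ⬝ᵥ e) :=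
    abs_dotProduct_mulVec_le hδ (by simpa using hΔ) e e
  have h2 : |e ⬝ᵥ Q' *ᵥ d| ≤ C * m * (b ^ 2 * (e ⬝ᵥ e) + d ⬝ᵥ d) :=
    abs_dotProduct_mulVec_le hC hQ' e d
  have h3 : |d ⬝ᵥ Q' *ᵥ e| ≤ C * m * (b ^ 2 * (e ⬝ᵥ e) + d ⬝ᵥ d) := by
    have : d ⬝ᵥ Q' *ᵥ e = e ⬝ᵥ Q'ᵀ *ᵥ d := by
      rw [dotProduct_mulVec, ← mulVec_transpose, dotProduct_comm]
    rw [this]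
    exact abs_dotProduct_mulVec_le hC (fun i j => hQ' j i) e d
  have h4 : |d ⬝ᵥ Q' *ᵥ d| ≤ (C * b) * m * (1 ^ 2 * (d ⬝ᵥ d) + d ⬝ᵥ d) :=
    abs_dotProduct_mulVec_le (by positivity) (by simpa using hQ') d d
  have hdd0 := dotProduct_self_nonneg' d
  have h4' : (C * b) * m * (1 ^ 2 * (d ⬝ᵥ d) + d ⬝ᵥ d) ≤ 2 * C * b₀ * m * (d ⬝ᵥ d) := by
    have : C * b * m * (d ⬝ᵥ d) ≤ C * b₀ * m * (d ⬝ᵥ d) := by gcongr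
    linarith
  have h5 : d ⬝ᵥ d ≤ 2 * (m ^ 2 * (C * b) ^ 2 * (e ⬝ᵥ e)) + 2 * (w ⬝ᵥ w) := by
    have h6 := mulVec_dotProduct_mulVec_le hG e
    have h7 := dotProduct_self_nonneg' (G *ᵥ e + w)
    have h8 : d ⬝ᵥ d + (G *ᵥ e + w) ⬝ᵥ (G *ᵥ e + w)
        = 2 * ((G *ᵥ e) ⬝ᵥ (G *ᵥ e)) + 2 * (w ⬝ᵥ w) := by
      rw [hd]
      simp only [add_dotProduct, dotProduct_add, neg_dotProduct, dotProduct_neg]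
      ring
    linarith
  have hexp : e' ⬝ᵥ e' - 2 * (e' ⬝ᵥ Q' *ᵥ e') = e ⬝ᵥ e - 2 * (e ⬝ᵥ Q *ᵥ e)
      - 2 * (e ⬝ᵥ Gm *ᵥ e) + (2 * (e ⬝ᵥ w) - 2 * (e ⬝ᵥ F *ᵥ e)) - 2 * (e ⬝ᵥ Δ *ᵥ e)
      + d ⬝ᵥ d - 2 * (e ⬝ᵥ Q' *ᵥ d) - 2 * (d ⬝ᵥ Q' *ᵥ e) - 2 * (d ⬝ᵥ Q' *ᵥ d) := by
    have h9 : e ⬝ᵥ d = -(e ⬝ᵥ Gm *ᵥ e + e ⬝ᵥ F *ᵥ e + e ⬝ᵥ Q *ᵥ e - e ⬝ᵥ Q' *ᵥ e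
        + e ⬝ᵥ Δ *ᵥ e) + e ⬝ᵥ w := by
      rw [hd, hGe]
      simp only [dotProduct_add, dotProduct_neg, dotProduct_sub]
    rw [hed]
    simp only [add_dotProduct, dotProduct_add, mulVec_add]
    rw [dotProduct_comm d e, h9]
    ring
  have h10 : (1 + 4 * C * m + 4 * C * b₀ * m) * (d ⬝ᵥ d) ≤
      (1 + 4 * C * m + 4 * C * b₀ * m)
        * (2 * (m ^ 2 * (C * b) ^ 2 * (e ⬝ᵥ e)) + 2 * (w ⬝ᵥ w)) := by
    have : 0 ≤ b₀ := hb.trans hbb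
    exact mul_le_mul_of_nonneg_left h5 (by positivity)
  rw [hexp]
  nlinarith [neg_le_of_abs_le h1, neg_le_of_abs_le h2, neg_le_of_abs_le h3, neg_le_of_abs_le h4]

end QuadraticForms

/-- Mean square and almost sure convergence to zero of a linear stochastic recursion
`e (k+1) = e k - G k e k + w k` whose random gain matrices average to coercive ones, up to
conditionally centred fluctuations `F`, increments of a small corrector `Q` and a summable
remainder. -/
theorem tendsto_zero_of_linear_recursion {Ω ι : Type*} [Fintype ι] {m0 : MeasurableSpace Ω}
    {μ : Measure Ω} [IsProbabilityMeasure μ] (ℱ : Filtration ℕ m0)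
    {e w : ℕ → Ω → ι → ℝ} {G F Q : ℕ → Ω → Matrix ι ι ℝ} {Gm : ℕ → Matrix ι ι ℝ}
    {C : ℝ} {b α δ η : ℕ → ℝ} (hC : 0 ≤ C) (hb : ∀ k, 0 ≤ b k) (hbanti : Antitone b)
    (hblim : Tendsto b atTop (𝓝 0)) (hbs : Summable fun k => b k ^ 2)
    (hα : ∀ k, 0 ≤ α k) (hαd : Tendsto (fun K => ∑ k ∈ Finset.range K, α k) atTop atTop)
    (hδ : ∀ k, 0 ≤ δ k) (hδs : Summable δ) (hη : ∀ k, 0 ≤ η k) (hηs : Summable η)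
    (hrec : ∀ k ω, e (k + 1) ω = e k ω - G k ω *ᵥ e k ω + w k ω)
    (hG : ∀ k ω i j, |G k ω i j| ≤ C * b k)
    (hGm : ∀ k u, α k * (u ⬝ᵥ u) ≤ u ⬝ᵥ Gm k *ᵥ u)
    (hQ : ∀ k, ∀ᵐ ω ∂μ, ∀ i j, |Q k ω i j| ≤ C * b k)
    (hF : ∀ k i j, ∃ c, ∀ᵐ ω ∂μ, |F k ω i j| ≤ c)
    (hΔ : ∀ k, ∀ᵐ ω ∂μ, ∀ i j,
      |(G k ω - (Gm k + F k ω + Q k ω - Q (k + 1) ω)) i j| ≤ δ k)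
    (he_adp : ∀ k i, StronglyMeasurable[ℱ k] fun ω => e k ω i)
    (hQ_adp : ∀ k i j, StronglyMeasurable[ℱ k] fun ω => Q k ω i j)
    (hGmeas : ∀ k i j, AEStronglyMeasurable (fun ω => G k ω i j) μ)
    (hFmeas : ∀ k i j, AEStronglyMeasurable (fun ω => F k ω i j) μ)
    (he0 : ∀ i, MemLp (fun ω => e 0 ω i) 2 μ) (hwL2 : ∀ k i, MemLp (fun ω => w k ω i) 2 μ)
    (hFc : ∀ k i j, μ[fun ω => F k ω i j|ℱ k] =ᵐ[μ] 0)
    (hwc : ∀ k i, μ[fun ω => w k ω i|ℱ k] =ᵐ[μ] 0)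
    (hw2 : ∀ k, μ[fun ω => w k ω ⬝ᵥ w k ω|ℱ k] ≤ᵐ[μ] fun _ => η k) :
    (∀ k, Integrable (fun ω => e k ω ⬝ᵥ e k ω) μ) ∧
      Tendsto (fun k => ∫ ω, e k ω ⬝ᵥ e k ω ∂μ) atTop (𝓝 0) ∧
      ∀ᵐ ω ∂μ, Tendsto (fun k => e k ω ⬝ᵥ e k ω) atTop (𝓝 0) := by
  set m : ℝ := (Fintype.card ι : ℝ) with hm
  have hm0 : 0 ≤ m := Nat.cast_nonneg _
  have heL2 : ∀ k i, MemLp (fun ω => e k ω i) 2 μ := by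
    intro k
    induction k with
    | zero => exact he0
    | succ k ih =>
      intro i
      have h1 : (fun ω => e (k + 1) ω i)
          = fun ω => e k ω i - (∑ j, G k ω i j * e k ω j) + w k ω i := by
        ext ω; rw [hrec]; simp [mulVec, dotProduct]
      rw [h1]
      refine ((ih i).sub (memLp_finsetSum _ fun j _ => ?_)).add (hwL2 k i)
      refine MemLp.of_le_mul (c := C * b k) (ih j) ((hGmeas k i j).mul (ih j).1) ?_
      filter_upwards with ω
      rw [norm_mul]
      exact mul_le_mul_of_nonneg_right (hG k ω i j) (norm_nonneg _)
  have hee : ∀ k i j, Integrable (fun ω => e k ω i * e k ω j) μ := fun k i j =>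
    (heL2 k i).integrable_mul (heL2 k j)
  have hew : ∀ k i, Integrable (fun ω => e k ω i * w k ω i) μ := fun k i =>
    (heL2 k i).integrable_mul (hwL2 k i)
  have hbil : ∀ k (M : Ω → Matrix ι ι ℝ), (∀ i j, AEStronglyMeasurable (fun ω => M ω i j) μ) →
      (∀ i j, ∃ c, ∀ᵐ ω ∂μ, |M ω i j| ≤ c) →
      ∀ i j, Integrable (fun ω => (e k ω i * e k ω j) * M ω i j) μ := by
    intro k M hM hMb i j
    obtain ⟨c, hc⟩ := hMb i j
    exact (hee k i j).mul_bdd (hM i j) hc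
  have hquad : ∀ (M : Matrix ι ι ℝ) (u : ι → ℝ),
      u ⬝ᵥ M *ᵥ u = ∑ i, ∑ j, (u i * u j) * M i j := by
    intro M u
    simp only [dotProduct, mulVec, Finset.mul_sum]
    exact Finset.sum_congr rfl fun i _ => Finset.sum_congr rfl fun j _ => by ring
  have hQm : ∀ k i j, AEStronglyMeasurable (fun ω => Q k ω i j) μ := fun k i j =>
    ((hQ_adp k i j).mono (ℱ.le k)).aestronglyMeasurable
  have hQb : ∀ k i j, ∃ c, ∀ᵐ ω ∂μ, |Q k ω i j| ≤ c := fun k i j =>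
    ⟨C * b k, by filter_upwards [hQ k] with ω hω using hω i j⟩
  have hVint : ∀ k, Integrable (fun ω => e k ω ⬝ᵥ e k ω) μ := fun k =>
    integrable_finsetSum _ fun i _ => hee k i i
  have hwwint : ∀ k, Integrable (fun ω => w k ω ⬝ᵥ w k ω) μ := fun k =>
    integrable_finsetSum _ fun i _ => (hwL2 k i).integrable_mul (hwL2 k i)
  have hqint : ∀ k (M : Ω → Matrix ι ι ℝ), (∀ i j, AEStronglyMeasurable (fun ω => M ω i j) μ) →
      (∀ i j, ∃ c, ∀ᵐ ω ∂μ, |M ω i j| ≤ c) →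
      Integrable (fun ω => e k ω ⬝ᵥ M ω *ᵥ e k ω) μ := by
    intro k M hM hMb
    simp_rw [hquad]
    exact integrable_finsetSum _ fun i _ => integrable_finsetSum _ fun j _ => hbil k M hM hMb i j
  set W : ℕ → Ω → ℝ := fun k ω => e k ω ⬝ᵥ e k ω - 2 * (e k ω ⬝ᵥ Q k ω *ᵥ e k ω) with hWdef
  have hWint : ∀ k, Integrable (W k) μ := fun k =>
    (hVint k).sub ((hqint k _ (hQm k) (hQb k)).const_mul 2)
  have hVadp : ∀ k, StronglyMeasurable[ℱ k] fun ω => e k ω ⬝ᵥ e k ω := fun k =>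
    Finset.stronglyMeasurable_fun_sum _ fun i _ => (he_adp k i).mul (he_adp k i)
  have hWadp : ∀ k, StronglyMeasurable[ℱ k] (W k) := by
    intro k
    refine (hVadp k).sub (StronglyMeasurable.const_mul ?_ 2)
    simp_rw [hquad]
    exact Finset.stronglyMeasurable_fun_sum _ fun i _ => Finset.stronglyMeasurable_fun_sum _
      fun j _ => ((he_adp k i).mul (he_adp k j)).mul (hQ_adp k i j)
  -- the conditionally centred part of the increment
  set ξ : ℕ → Ω → ℝ := fun k ω => 2 * (e k ω ⬝ᵥ w k ω) - 2 * (e k ω ⬝ᵥ F k ω *ᵥ e k ω) with hξdef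
  have hξint : ∀ k, Integrable (ξ k) μ := fun k =>
    ((integrable_finsetSum _ fun i _ => hew k i).const_mul 2).sub
      ((hqint k _ (hFmeas k) (hF k)).const_mul 2)
  have hwint : ∀ k i, Integrable (fun ω => w k ω i) μ := fun k i =>
    (hwL2 k i).integrable one_le_two
  have hFint : ∀ k i j, Integrable (fun ω => F k ω i j) μ := fun k i j => by
    obtain ⟨c, hc⟩ := hF k i j
    exact Integrable.of_bound (hFmeas k i j) c hc
  have hξc : ∀ k, μ[ξ k|ℱ k] =ᵐ[μ] 0 := by
    intro k
    have h1 : ξ k = (2 : ℝ) • (∑ i, fun ω => e k ω i * w k ω i)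
        - (2 : ℝ) • (∑ i, ∑ j, fun ω => (e k ω i * e k ω j) * F k ω i j) := by
      ext ω
      simp only [hξdef, hquad, Pi.sub_apply, Pi.smul_apply, Finset.sum_apply, smul_eq_mul]
      rfl
    have i1 : Integrable (∑ i, fun ω => e k ω i * w k ω i) μ :=
      integrable_finsetSum' _ fun i _ => hew k i
    have i3 : ∀ i, Integrable (∑ j, fun ω => (e k ω i * e k ω j) * F k ω i j) μ := fun i =>
      integrable_finsetSum' _ fun j _ => hbil k _ (hFmeas k) (hF k) i j
    have i2 : Integrable (∑ i, ∑ j, fun ω => (e k ω i * e k ω j) * F k ω i j) μ :=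
      integrable_finsetSum' _ fun i _ => i3 i
    have c1 : ∀ i, μ[fun ω => e k ω i * w k ω i|ℱ k] =ᵐ[μ] 0 := by
      intro i
      refine (condExp_mul_of_stronglyMeasurable_left (he_adp k i) (hew k i) (hwint k i)).trans ?_
      filter_upwards [hwc k i] with ω hω
      simp [hω]
    have c2 : ∀ i j, μ[fun ω => (e k ω i * e k ω j) * F k ω i j|ℱ k] =ᵐ[μ] 0 := by
      intro i j
      refine (condExp_mul_of_stronglyMeasurable_left ((he_adp k i).mul (he_adp k j))
        (hbil k _ (hFmeas k) (hF k) i j) (hFint k i j)).trans ?_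
      filter_upwards [hFc k i j] with ω hω
      simp [hω]
    have c1' : μ[∑ i, fun ω => e k ω i * w k ω i|ℱ k] =ᵐ[μ] 0 := by
      refine (condExp_finsetSum (fun i _ => hew k i) _).trans ?_
      filter_upwards [ae_all_iff.2 c1] with ω hω
      simp [hω]
    have c2' : μ[∑ i, ∑ j, fun ω => (e k ω i * e k ω j) * F k ω i j|ℱ k] =ᵐ[μ] 0 := by
      refine (condExp_finsetSum (fun i _ => i3 i) _).trans ?_
      have : ∀ i, μ[∑ j, fun ω => (e k ω i * e k ω j) * F k ω i j|ℱ k] =ᵐ[μ] 0 := by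
        intro i
        refine (condExp_finsetSum (fun j _ => hbil k _ (hFmeas k) (hF k) i j) _).trans ?_
        filter_upwards [ae_all_iff.2 (c2 i)] with ω hω
        simp [hω]
      filter_upwards [ae_all_iff.2 this] with ω hω
      simp [hω]
    rw [h1]
    refine (condExp_sub (i1.smul _) (i2.smul _) _).trans ?_
    filter_upwards [condExp_smul (2 : ℝ) (∑ i, fun ω => e k ω i * w k ω i) (μ := μ) (ℱ k),
      condExp_smul (2 : ℝ) (∑ i, ∑ j, fun ω => (e k ω i * e k ω j) * F k ω i j) (μ := μ) (ℱ k),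
      c1', c2'] with ω h1 h2 h3 h4
    simp [h1, h2, h3, h4]
  set K : ℝ := 1 + 4 * C * m + 4 * C * b 0 * m with hK
  have hb0 := hb 0
  have hK0 : 0 ≤ K := by positivity
  set γ : ℕ → ℝ := fun k => 4 * m * δ k + (4 * C * m + 2 * K * (m ^ 2 * C ^ 2)) * b k ^ 2 with hγ
  have hγ0 : ∀ k, 0 ≤ γ k := fun k => by have := hδ k; positivity
  have hγs : Summable γ := (hδs.mul_left _).add (hbs.mul_left _)
  have hdrift : ∀ k, μ[W (k + 1)|ℱ k] ≤ᵐ[μ] fun ω =>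
      W k ω + (γ k - 2 * α k) * (e k ω ⬝ᵥ e k ω) + 2 * K * η k := by
    intro k
    set A1 : Ω → ℝ := fun ω => W k ω + (γ k - 2 * α k) * (e k ω ⬝ᵥ e k ω) with hA1
    have hA1int : Integrable A1 μ := (hWint k).add ((hVint k).const_mul _)
    have hA1adp : StronglyMeasurable[ℱ k] A1 := (hWadp k).add ((hVadp k).const_mul _)
    set A2 : Ω → ℝ := (2 * K) • fun ω => w k ω ⬝ᵥ w k ω with hA2
    have hA2int : Integrable A2 μ := (hwwint k).smul _
    have hpt : W (k + 1) ≤ᵐ[μ] A1 + ξ k + A2 := by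
      filter_upwards [hΔ k, hQ (k + 1)] with ω h1 h2
      have h2' : ∀ i j, |Q (k + 1) ω i j| ≤ C * b k := fun i j =>
        (h2 i j).trans (mul_le_mul_of_nonneg_left (hbanti (Nat.le_succ k)) hC)
      have h3 := perturbed_lyapunov_step hC (hb k) (hbanti (Nat.zero_le k)) (hδ k) (hG k ω) h2' h1
        (e k ω) (w k ω) (e (k + 1) ω) (hrec k ω)
      have h4 := hGm k (e k ω)
      simp only [hA1, hA2, hWdef, hξdef, Pi.add_apply, Pi.smul_apply, smul_eq_mul, hγ, hK, hm] at *
      linarith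
    have hce : μ[A1 + ξ k + A2|ℱ k] =ᵐ[μ] fun ω =>
        A1 ω + 2 * K * (μ[fun ω => w k ω ⬝ᵥ w k ω|ℱ k]) ω := by
      filter_upwards [condExp_add (hA1int.add (hξint k)) hA2int (ℱ k),
        condExp_add hA1int (hξint k) (ℱ k), hξc k,
        condExp_smul (2 * K) (fun ω => w k ω ⬝ᵥ w k ω) (μ := μ) (ℱ k)] with ω h1 h2 h3 h4
      rw [h1, Pi.add_apply, h2, Pi.add_apply, h3, hA2, h4,
        condExp_of_stronglyMeasurable (ℱ.le k) hA1adp hA1int]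
      simp
    filter_upwards [condExp_mono (m := ℱ k) (hWint (k + 1)) ((hA1int.add (hξint k)).add hA2int) hpt,
      hce, hw2 k] with ω h1 h2 h3
    rw [h2] at h1
    have := mul_le_mul_of_nonneg_left h3 (by positivity : 0 ≤ 2 * K)
    linarith
  -- comparison of `W` with the squared norm for large times
  obtain ⟨k₀, hk₀⟩ : ∃ k₀, ∀ k, k₀ ≤ k → 4 * C * m * b k ≤ 1 / 2 := by
    have h1 : Tendsto (fun k => 4 * C * m * b k) atTop (𝓝 0) := by
      simpa using hblim.const_mul (4 * C * m)
    exact eventually_atTop.1 (h1.eventually (ge_mem_nhds (by norm_num)))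
  have hcmp : ∀ k, k₀ ≤ k → ∀ᵐ ω ∂μ, e k ω ⬝ᵥ e k ω ≤ 2 * W k ω ∧
      W k ω ≤ 2 * (e k ω ⬝ᵥ e k ω) := by
    intro k hk
    filter_upwards [hQ k] with ω h1
    have h2 : |e k ω ⬝ᵥ Q k ω *ᵥ e k ω| ≤
        (C * b k) * m * (1 ^ 2 * (e k ω ⬝ᵥ e k ω) + e k ω ⬝ᵥ e k ω) :=
      abs_dotProduct_mulVec_le (mul_nonneg hC (hb k)) (by simpa using h1) _ _
    have h3 := dotProduct_self_nonneg' (e k ω)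
    have h4 := mul_le_mul_of_nonneg_right (hk₀ k hk) h3
    have h5 := abs_le.1 h2
    simp only [hWdef]
    constructor <;> linarith [h5.1, h5.2]
  let ℱ' : Filtration ℕ m0 := ⟨fun k => ℱ (k + k₀), fun i j hij => ℱ.mono (by omega),
    fun k => ℱ.le _⟩
  have hαd' : Tendsto (fun K => ∑ k ∈ Finset.range K, α (k + k₀)) atTop atTop := by
    have h1 : ∀ K, ∑ k ∈ Finset.range K, α (k + k₀)
        = ∑ k ∈ Finset.range (K + k₀), α k - ∑ k ∈ Finset.range k₀, α k := by
      intro K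
      rw [add_comm K, Finset.sum_range_add]
      simp [add_comm]
    simp_rw [h1]
    exact tendsto_atTop_add_const_right _ _ (hαd.comp (tendsto_add_atTop_nat k₀))
  have hRS := tendsto_zero_of_condExp_contraction (μ := μ) ℱ' (W := fun k => W (k + k₀))
    (α := fun k => α (k + k₀)) (γ := fun k => 2 * γ (k + k₀)) (η := fun k => 2 * K * η (k + k₀))
    (fun k => hWadp _) (fun k => hWint _)
    (fun k => by
      filter_upwards [hcmp (k + k₀) (Nat.le_add_left _ _)] with ω hω
      have := dotProduct_self_nonneg' (e (k + k₀) ω)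
      simp only [Pi.zero_apply]
      linarith [hω.1])
    (fun k => hα _) (fun k => mul_nonneg zero_le_two (hγ0 _))
    (fun k => mul_nonneg (by positivity) (hη _))
    (((summable_nat_add_iff k₀).2 hγs).mul_left 2) (((summable_nat_add_iff k₀).2 hηs).mul_left _)
    hαd' (fun k => by
      have h0 := hdrift (k + k₀)
      rw [add_right_comm] at h0
      filter_upwards [h0, hcmp (k + k₀) (Nat.le_add_left _ _)] with ω h1 h2
      refine h1.trans ?_
      have h3 := mul_le_mul_of_nonneg_left h2.1 (hγ0 (k + k₀))
      have h4 := mul_le_mul_of_nonneg_left h2.2 (hα (k + k₀))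
      linarith)
  refine ⟨hVint, ?_, ?_⟩
  · rw [← tendsto_add_atTop_iff_nat k₀]
    refine squeeze_zero (fun k => integral_nonneg fun ω => dotProduct_self_nonneg' _)
      (fun k => ?_) (by simpa using hRS.1.const_mul 2)
    rw [← integral_const_mul]
    refine integral_mono_ae (hVint _) ((hWint _).const_mul 2) ?_
    filter_upwards [hcmp (k + k₀) (Nat.le_add_left _ _)] with ω hω using hω.1
  · filter_upwards [hRS.2, ae_all_iff.2 fun k => hcmp (k + k₀) (Nat.le_add_left _ _)]
      with ω h1 h2
    rw [← tendsto_add_atTop_iff_nat k₀]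
    exact squeeze_zero (fun k => dotProduct_self_nonneg' _) (fun k => (h2 k).1)
      (by simpa using h1.const_mul 2)

lemma summable_mul_of_abs_le {p f : ℕ → ℝ} {C : ℝ} (hp : ∀ l, 0 ≤ p l) (hps : Summable p)
    (hf : ∀ l, |f l| ≤ C) : Summable fun l => p l * f l :=
  Summable.of_norm_bounded (hps.mul_right C) fun l => by
    rw [norm_mul, Real.norm_of_nonneg (hp l)]
    exact mul_le_mul_of_nonneg_left (hf l) (hp l)

lemma abs_tsum_mul_le {p f : ℕ → ℝ} {C : ℝ} (hp : ∀ l, 0 ≤ p l) (hps : HasSum p 1)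
    (hf : ∀ l, |f l| ≤ C) : |∑' l, p l * f l| ≤ C := by
  have h := tsum_of_norm_bounded (hps.mul_right C) (f := fun l => p l * f l) fun l => by
    rw [norm_mul, Real.norm_of_nonneg (hp l)]
    exact mul_le_mul_of_nonneg_left (hf l) (hp l)
  simpa using h

/-- Composition of a row vector with a stochastic kernel, tested against a bounded function. -/
lemma tsum_kernel_comp {q f : ℕ → ℝ} {P : ℕ → ℕ → ℝ} {C : ℝ} (hq : ∀ l, 0 ≤ q l)
    (hqs : Summable q) (hP : ∀ s l, 0 ≤ P s l) (hPs : ∀ s, HasSum (P s) 1)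
    (hf : ∀ l, |f l| ≤ C) :
    (Summable fun l => ∑' l', q l' * P l' l) ∧
    ∑' l, (∑' l', q l' * P l' l) * f l = ∑' l', q l' * ∑' l, P l' l * f l := by
  have hsum : Summable (Function.uncurry fun l' l => q l' * P l' l) := by
    refine (summable_prod_of_nonneg fun x => mul_nonneg (hq x.1) (hP x.1 x.2)).2 ⟨fun l' => (hPs l').summable.mul_left (q l'), ?_⟩
    simp only [tsum_mul_left, (hPs _).tsum_eq, mul_one]
    exact hqs
  have hsumf : Summable (Function.uncurry fun l' l => q l' * P l' l * f l) := by
    refine Summable.of_norm_bounded (hsum.mul_right C) fun x => ?_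
    simp only [Function.uncurry]
    rw [norm_mul, Real.norm_of_nonneg (mul_nonneg (hq _) (hP _ _))]
    exact mul_le_mul_of_nonneg_left (hf _) (mul_nonneg (hq _) (hP _ _))
  refine ⟨hsum.prod_symm.prod, ?_⟩
  calc ∑' l, (∑' l', q l' * P l' l) * f l = ∑' l, ∑' l', q l' * P l' l * f l := by
        simp_rw [tsum_mul_right]
    _ = ∑' l', ∑' l, q l' * P l' l * f l := hsumf.tsum_comm
    _ = _ := by simp_rw [mul_assoc, tsum_mul_left]

/-- Bounded solutions of the Poisson equation of a uniformly ergodic Markov chain. -/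
theorem exists_bounded_poisson_solution {P : ℕ → ℕ → ℝ} (hP : ∀ s l, 0 ≤ P s l)
    (hPs : ∀ s, HasSum (P s) 1) {Pm : ℕ → ℕ → ℕ → ℝ} (hPm1 : ∀ s l, Pm 1 s l = P s l)
    (hPmCK : ∀ m s l, Pm (m + 1) s l = ∑' l', Pm m s l' * P l' l)
    {ϖ : ℕ → ℝ} (hϖ : ∀ l, 0 ≤ ϖ l) (hϖs : HasSum ϖ 1) {R r : ℝ} (hr : 1 < r)
    (herg : ∀ s m, 1 ≤ m → ∑' l, |Pm m s l - ϖ l| ≤ R / r ^ m)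
    {f : ℕ → ℝ} {C : ℝ} (hf : ∀ l, |f l| ≤ C) :
    ∃ (U : ℕ → ℝ) (B : ℝ), (∀ l, |U l| ≤ B) ∧
      ∀ s, U s - ∑' l, P s l * U l = f s - ∑' l, ϖ l * f l := by
  have hC0 : 0 ≤ C := (abs_nonneg _).trans (hf 0)
  have hrpos : 0 < r := one_pos.trans hr
  have hPmpos : ∀ m s, (∀ l, 0 ≤ Pm (m + 1) s l) ∧ Summable (Pm (m + 1) s) := by
    intro m s
    induction m with
    | zero =>
      have : Pm (0 + 1) s = P s := funext (hPm1 s)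
      rw [this]
      exact ⟨hP s, (hPs s).summable⟩
    | succ m ih =>
      have : Pm (m + 1 + 1) s = fun l => ∑' l', Pm (m + 1) s l' * P l' l := funext (hPmCK _ s)
      rw [this]
      exact ⟨fun l => tsum_nonneg fun l' => mul_nonneg (ih.1 l') (hP l' l),
        (tsum_kernel_comp ih.1 ih.2 hP hPs hf).1⟩
  let T : (ℕ → ℝ) → ℕ → ℝ := fun g s => ∑' l, P s l * g l
  have hT : ∀ {g : ℕ → ℝ}, (∀ l, |g l| ≤ C) → ∀ s, |T g s| ≤ C := fun hg s =>
    abs_tsum_mul_le (hP s) (hPs s) hg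
  have hTit : ∀ m, ∀ g : ℕ → ℝ, (∀ l, |g l| ≤ C) → ∀ s, |T^[m] g s| ≤ C := by
    intro m
    induction m with
    | zero => exact fun g hg => hg
    | succ m ih => exact fun g hg => ih (T g) (hT hg)
  have hPmT : ∀ m, ∀ g : ℕ → ℝ, (∀ l, |g l| ≤ C) → ∀ s,
      ∑' l, Pm (m + 1) s l * g l = T^[m + 1] g s := by
    intro m
    induction m with
    | zero => intro g _ s; simp [T, hPm1]
    | succ m ih =>
      intro g hg s
      rw [Function.iterate_succ_apply, ← ih (T g) (hT hg)]
      simp_rw [hPmCK (m + 1) s]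
      exact (tsum_kernel_comp (hPmpos m s).1 (hPmpos m s).2 hP hPs hg).2
  set fbar := ∑' l, ϖ l * f l with hfbar
  have hfbarC : |fbar| ≤ C := abs_tsum_mul_le hϖ hϖs hf
  -- geometric decay of the centred iterates
  set D := 2 * C + C * |R| with hD
  have hD0 : 0 ≤ D := by positivity
  have hdecay : ∀ m s, |T^[m] f s - fbar| ≤ D * (r⁻¹) ^ m := by
    intro m s
    rcases m with _ | m
    · have h1 : |f s - fbar| ≤ C + C := (abs_sub _ _).trans (add_le_add (hf s) hfbarC)
      simp only [Function.iterate_zero, id, pow_zero, mul_one]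
      have : 0 ≤ C * |R| := by positivity
      linarith
    · rw [← hPmT m f hf s, hfbar, ← (summable_mul_of_abs_le (hPmpos m s).1 (hPmpos m s).2 hf).tsum_sub
        (summable_mul_of_abs_le hϖ hϖs.summable hf)]
      have hsabs : Summable fun l => |Pm (m + 1) s l - ϖ l| :=
        ((hPmpos m s).2.sub hϖs.summable).abs
      have h2 : |∑' l, (Pm (m + 1) s l * f l - ϖ l * f l)| ≤
          (∑' l, |Pm (m + 1) s l - ϖ l|) * C := by
        rw [← Real.norm_eq_abs]
        refine tsum_of_norm_bounded (hsabs.hasSum.mul_right C) fun l => ?_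
        rw [← sub_mul, norm_mul]
        exact mul_le_mul_of_nonneg_left (hf l) (norm_nonneg _)
      refine h2.trans ((mul_le_mul_of_nonneg_right (herg s (m + 1) (by omega)) hC0).trans ?_)
      rw [inv_pow, div_mul_eq_mul_div, ← div_eq_mul_inv]
      refine div_le_div_of_nonneg_right ?_ (by positivity)
      have := mul_le_mul_of_nonneg_left (le_abs_self R) hC0
      linarith
  have hgeo : Summable fun m => D * (r⁻¹) ^ m :=
    (summable_geometric_of_lt_one (inv_nonneg.2 hrpos.le) (inv_lt_one_of_one_lt₀ hr)).mul_left D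
  have hUs : ∀ s, Summable fun m => T^[m] f s - fbar := fun s =>
    Summable.of_norm_bounded hgeo fun m => hdecay m s
  refine ⟨fun s => ∑' m, (T^[m] f s - fbar), ∑' m, D * (r⁻¹) ^ m,
    fun s => ?_, fun s => ?_⟩
  · rw [← Real.norm_eq_abs]
    exact tsum_of_norm_bounded hgeo.hasSum fun m => hdecay m s
  have hdouble : Summable (Function.uncurry fun l m => P s l * (T^[m] f l - fbar)) := by
    refine Summable.of_norm_bounded
      ((hPs s).summable.mul_of_nonneg hgeo (hP s) fun m => by positivity) fun x => ?_
    simp only [Function.uncurry]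
    rw [norm_mul, Real.norm_of_nonneg (hP _ _)]
    exact mul_le_mul_of_nonneg_left (hdecay _ _) (hP _ _)
  have hTm : ∀ m, ∑' l, P s l * (T^[m] f l - fbar) = T^[m + 1] f s - fbar := by
    intro m
    simp_rw [mul_sub]
    rw [(summable_mul_of_abs_le (hP s) (hPs s).summable (hTit m f hf)).tsum_sub
      ((hPs s).summable.mul_right _), tsum_mul_right, (hPs s).tsum_eq, one_mul,
      Function.iterate_succ_apply']
  simp_rw [← tsum_mul_left]
  rw [← hdouble.tsum_comm]
  simp_rw [hTm]
  rw [(hUs s).tsum_eq_zero_add]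
  simp

lemma stronglyMeasurable_limUnder_sum {Ω : Type*} {m : MeasurableSpace Ω} {g : ℕ → Ω → ℝ}
    (hg : ∀ l, StronglyMeasurable (g l)) :
    StronglyMeasurable fun ω => limUnder atTop fun n => ∑ l ∈ Finset.range n, g l ω :=
  StronglyMeasurable.limUnder fun _ => Finset.stronglyMeasurable_fun_sum _ fun l _ => hg l

/-- The one-step Markov property, extended from indicators to bounded functions. -/
theorem condExp_comp_markov {Ω : Type*} {m m0 : MeasurableSpace Ω} {μ : Measure Ω}
    [IsProbabilityMeasure μ] (hm : m ≤ m0) {X Y : Ω → ℕ} (hX : Measurable X) (hY : Measurable Y)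
    {P : ℕ → ℕ → ℝ} (hP : ∀ s l, 0 ≤ P s l) (hPs : ∀ s, HasSum (P s) 1)
    (hMarkov : ∀ l, μ[fun ω => if Y ω = l then (1 : ℝ) else 0|m] =ᵐ[μ] fun ω => P (X ω) l)
    {U : ℕ → ℝ} {B : ℝ} (hU : ∀ l, |U l| ≤ B) :
    μ[fun ω => U (Y ω)|m] =ᵐ[μ] fun ω => ∑' l, P (X ω) l * U l := by
  have hB0 : 0 ≤ B := (abs_nonneg _).trans (hU 0)
  have hind : ∀ l, Integrable (fun ω => if Y ω = l then (1 : ℝ) else 0) μ := fun l =>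
    Integrable.of_bound ((measurable_of_countable fun y : ℕ => if y = l then (1 : ℝ) else 0).comp
      hY).aestronglyMeasurable 1 (ae_of_all _ fun ω => by dsimp; split_ifs <;> simp)
  have hPint : ∀ l, Integrable (fun ω => P (X ω) l) μ := fun l =>
    Integrable.of_bound ((measurable_of_countable fun x : ℕ => P x l).comp
      hX).aestronglyMeasurable 1 (ae_of_all _ fun ω => by
        rw [Real.norm_of_nonneg (hP _ _)]
        exact le_hasSum (hPs (X ω)) l fun j _ => hP _ j)
  have hPm : ∀ l, AEStronglyMeasurable[m] (fun ω => P (X ω) l) μ := fun l =>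
    ⟨_, stronglyMeasurable_condExp, (hMarkov l).symm⟩
  have hlim : ∀ s, Tendsto (fun n => ∑ l ∈ Finset.range n, P s l * U l) atTop
      (𝓝 (∑' l, P s l * U l)) := fun s =>
    (summable_mul_of_abs_le (hP s) (hPs s).summable hU).hasSum.tendsto_sum_nat
  have hg : AEStronglyMeasurable[m] (fun ω => ∑' l, P (X ω) l * U l) μ := by
    choose g hgm hgP using hPm
    refine ⟨fun ω => limUnder atTop fun n => ∑ l ∈ Finset.range n, g l ω * U l,
      stronglyMeasurable_limUnder_sum fun l => (hgm l).mul_const (U l), ?_⟩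
    filter_upwards [ae_all_iff.2 hgP] with ω hω
    simp_rw [← hω]
    exact (hlim (X ω)).limUnder_eq.symm
  have hgint : Integrable (fun ω => ∑' l, P (X ω) l * U l) μ :=
    Integrable.of_bound (hg.mono hm) B
      (ae_of_all _ fun ω => abs_tsum_mul_le (hP _) (hPs _) hU)
  refine (tendsto_condExp_unique
    (fun n ω => ∑ l ∈ Finset.range n, (if Y ω = l then (1 : ℝ) else 0) * U l)
    (fun n ω => ∑ l ∈ Finset.range n, P (X ω) l * U l) (fun ω => U (Y ω))
    (fun ω => ∑' l, P (X ω) l * U l)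
    (fun n => integrable_finsetSum _ fun l _ => (hind l).mul_const _)
    (fun n => integrable_finsetSum _ fun l _ => (hPint l).mul_const _)
    (ae_of_all _ fun ω => ?_) (ae_of_all _ fun ω => hlim _) (fun _ => B) (integrable_const _)
    (fun _ => B) (integrable_const _) (fun n => ae_of_all _ fun ω => ?_)
    (fun n => ae_of_all _ fun ω => ?_) fun n => ?_).trans
      (condExp_of_aestronglyMeasurable' hm hg hgint)
  · refine tendsto_const_nhds.congr' ?_
    filter_upwards [eventually_gt_atTop (Y ω)] with n hn
    simp [hn]
  · simp only [ite_mul, one_mul, zero_mul, Finset.sum_ite_eq]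
    split_ifs
    · exact hU _
    · simpa using hB0
  · calc ‖∑ l ∈ Finset.range n, P (X ω) l * U l‖ ≤ ∑ l ∈ Finset.range n, P (X ω) l * B := by
          refine norm_sum_le_of_le _ fun l _ => ?_
          rw [norm_mul, Real.norm_of_nonneg (hP _ _)]
          exact mul_le_mul_of_nonneg_left (hU l) (hP _ _)
      _ = (∑ l ∈ Finset.range n, P (X ω) l) * B := (Finset.sum_mul _ _ _).symm
      _ ≤ 1 * B := mul_le_mul_of_nonneg_right
          (sum_le_hasSum _ (fun l _ => hP _ l) (hPs (X ω))) hB0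
      _ = B := one_mul B
  · have h1 : (fun ω => ∑ l ∈ Finset.range n, (if Y ω = l then (1 : ℝ) else 0) * U l)
        = ∑ l ∈ Finset.range n, U l • fun ω => if Y ω = l then (1 : ℝ) else 0 := by
      ext ω
      simp [Finset.sum_apply, mul_comm]
    have h2 : (fun ω => ∑ l ∈ Finset.range n, P (X ω) l * U l)
        = ∑ l ∈ Finset.range n, U l • fun ω => P (X ω) l := by
      ext ω
      simp [Finset.sum_apply, mul_comm]
    rw [h1, h2]
    refine (condExp_finsetSum (fun l _ => (hind l).smul _) _).trans
      (EventuallyEq.trans ?_ (condExp_finsetSum (fun l _ => (hPint l).smul _) _).symm)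
    have h3 : ∀ l, μ[U l • fun ω => if Y ω = l then (1 : ℝ) else 0|m] =ᵐ[μ]
        μ[U l • fun ω => P (X ω) l|m] := by
      intro l
      filter_upwards [condExp_smul (U l) (fun ω => if Y ω = l then (1 : ℝ) else 0) (μ := μ) m,
        condExp_smul (U l) (fun ω => P (X ω) l) (μ := μ) m, hMarkov l,
        condExp_of_aestronglyMeasurable' hm (hPm l) (hPint l)] with ω a1 a2 a3 a4
      simp [a1, a2, a3, a4]
    filter_upwards [ae_all_iff.2 h3] with ω hω
    simp [Finset.sum_apply, hω]

lemma summable_sub_succ_of_antitone {a : ℕ → ℝ} (ha : ∀ k, 0 ≤ a k) (hanti : Antitone a) :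
    Summable fun k => a k - a (k + 1) :=
  summable_of_sum_range_le (c := a 0) (fun k => sub_nonneg.2 (hanti k.le_succ)) fun K => by
    rw [Finset.sum_range_sub']
    linarith [ha K]

/-- Convergence of a linear recursion whose gain matrices are modulated by a uniformly ergodic
Markov chain and whose stationary average is coercive. -/
theorem tendsto_zero_of_markov_modulated_recursion {Ω ι : Type*} [Fintype ι]
    {m0 : MeasurableSpace Ω} {μ : Measure Ω} [IsProbabilityMeasure μ] (ℱ : Filtration ℕ m0)
    {e w : ℕ → Ω → ι → ℝ} {D L : ℕ → Matrix ι ι ℝ} {a b α η : ℕ → ℝ} {B C : ℝ}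
    (ha : ∀ k, 0 ≤ a k) (hb : ∀ k, 0 ≤ b k) (haanti : Antitone a) (hbanti : Antitone b)
    (hblim : Tendsto b atTop (𝓝 0)) (hbs : Summable fun k => b k ^ 2)
    (hC : 0 ≤ C) (hab : ∀ k, a k ≤ C * b k)
    (hD : ∀ l i j, |D l i j| ≤ B) (hL : ∀ l i j, |L l i j| ≤ B)
    {ℓ : ℕ → Ω → ℕ} (hℓ : ∀ k, Measurable (ℓ k))
    {P : ℕ → ℕ → ℝ} (hP : ∀ s l, 0 ≤ P s l) (hPs : ∀ s, HasSum (P s) 1)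
    (hMarkov : ∀ k l, μ[fun ω => if ℓ (k + 1) ω = l then (1 : ℝ) else 0|ℱ (k + 1)]
      =ᵐ[μ] fun ω => P (ℓ k ω) l)
    {Pm : ℕ → ℕ → ℕ → ℝ} (hPm1 : ∀ s l, Pm 1 s l = P s l)
    (hPmCK : ∀ m s l, Pm (m + 1) s l = ∑' l', Pm m s l' * P l' l)
    {ϖ : ℕ → ℝ} (hϖ : ∀ l, 0 ≤ ϖ l) (hϖs : HasSum ϖ 1) {R r : ℝ} (hr : 1 < r)
    (herg : ∀ s m, 1 ≤ m → ∑' l, |Pm m s l - ϖ l| ≤ R / r ^ m)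
    (hα : ∀ k, 0 ≤ α k) (hαd : Tendsto (fun K => ∑ k ∈ Finset.range K, α k) atTop atTop)
    (hη : ∀ k, 0 ≤ η k) (hηs : Summable η)
    (hcoer : ∀ k u, α k * (u ⬝ᵥ u) ≤ u ⬝ᵥ (a k • Matrix.of (fun i j => ∑' l, ϖ l * D l i j)
      + b k • Matrix.of (fun i j => ∑' l, ϖ l * L l i j)) *ᵥ u)
    (hrec : ∀ k ω, e (k + 1) ω
      = e k ω - (a k • D (ℓ k ω) + b k • L (ℓ k ω)) *ᵥ e k ω + w k ω)
    (he_adp : ∀ k i, StronglyMeasurable[ℱ k] fun ω => e k ω i)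
    (he0 : ∀ i, MemLp (fun ω => e 0 ω i) 2 μ) (hwL2 : ∀ k i, MemLp (fun ω => w k ω i) 2 μ)
    (hwc : ∀ k i, μ[fun ω => w k ω i|ℱ k] =ᵐ[μ] 0)
    (hw2 : ∀ k, μ[fun ω => w k ω ⬝ᵥ w k ω|ℱ k] ≤ᵐ[μ] fun _ => η k) :
    (∀ k, Integrable (fun ω => e k ω ⬝ᵥ e k ω) μ) ∧
      Tendsto (fun k => ∫ ω, e k ω ⬝ᵥ e k ω ∂μ) atTop (𝓝 0) ∧
      ∀ᵐ ω ∂μ, Tendsto (fun k => e k ω ⬝ᵥ e k ω) atTop (𝓝 0) := by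
  choose UD BD hUD hUDp using fun i j =>
    exists_bounded_poisson_solution hP hPs hPm1 hPmCK hϖ hϖs hr herg (f := fun l => D l i j)
      (fun l => hD l i j)
  choose UL BL hUL hULp using fun i j =>
    exists_bounded_poisson_solution hP hPs hPm1 hPmCK hϖ hϖs hr herg (f := fun l => L l i j)
      (fun l => hL l i j)
  obtain ⟨B', hB'0, hBB', hUDB, hULB⟩ : ∃ B' : ℝ, 0 ≤ B' ∧ B ≤ B' ∧
      (∀ i j l, |UD i j l| ≤ B') ∧ ∀ i j l, |UL i j l| ≤ B' := by
    have hBD : ∀ i j, 0 ≤ BD i j := fun i j => (abs_nonneg _).trans (hUD i j 0)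
    have hBL : ∀ i j, 0 ≤ BL i j := fun i j => (abs_nonneg _).trans (hUL i j 0)
    have hle : ∀ (f : ι → ι → ℝ), (∀ i j, 0 ≤ f i j) → ∀ i j, f i j ≤ ∑ i, ∑ j, f i j :=
      fun f hf i j => (Finset.single_le_sum (f := f i) (fun j _ => hf i j)
        (Finset.mem_univ j)).trans (Finset.single_le_sum (f := fun i => ∑ j, f i j)
          (fun i _ => Finset.sum_nonneg fun j _ => hf i j) (Finset.mem_univ i))
    have h1 : 0 ≤ ∑ i, ∑ j, BD i j := Finset.sum_nonneg fun i _ =>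
      Finset.sum_nonneg fun j _ => hBD i j
    have h2 : 0 ≤ ∑ i, ∑ j, BL i j := Finset.sum_nonneg fun i _ =>
      Finset.sum_nonneg fun j _ => hBL i j
    refine ⟨|B| + ∑ i, ∑ j, BD i j + ∑ i, ∑ j, BL i j, by positivity,
      by linarith [le_abs_self B], fun i j l => (hUD i j l).trans ?_,
      fun i j l => (hUL i j l).trans ?_⟩
    · linarith [hle BD hBD i j, abs_nonneg B]
    · linarith [hle BL hBL i j, abs_nonneg B]
  let VD : ℕ → ι → ι → Ω → ℝ := fun k i j => μ[fun ω => UD i j (ℓ k ω)|ℱ k]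
  let VL : ℕ → ι → ι → Ω → ℝ := fun k i j => μ[fun ω => UL i j (ℓ k ω)|ℱ k]
  have hVD : ∀ k, ∀ᵐ ω ∂μ, ∀ i j, |VD k i j ω| ≤ B' := fun k =>
    ae_all_iff.2 fun i => ae_all_iff.2 fun j => ae_bdd_abs_condExp_of_ae_bdd_abs (ae_of_all _ fun ω => hUDB i j _)
  have hVL : ∀ k, ∀ᵐ ω ∂μ, ∀ i j, |VL k i j ω| ≤ B' := fun k =>
    ae_all_iff.2 fun i => ae_all_iff.2 fun j => ae_bdd_abs_condExp_of_ae_bdd_abs (ae_of_all _ fun ω => hULB i j _)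
  have hcomp : ∀ (f : ℕ → ℝ) k, StronglyMeasurable fun ω => f (ℓ k ω) := fun f k =>
    ((measurable_of_countable f).comp (hℓ k)).stronglyMeasurable
  have hUDint : ∀ k i j, Integrable (fun ω => UD i j (ℓ k ω)) μ := fun k i j =>
    Integrable.of_bound (hcomp _ k).aestronglyMeasurable B' (ae_of_all _ fun ω => hUDB i j _)
  have hULint : ∀ k i j, Integrable (fun ω => UL i j (ℓ k ω)) μ := fun k i j =>
    Integrable.of_bound (hcomp _ k).aestronglyMeasurable B' (ae_of_all _ fun ω => hULB i j _)
  have hlin : ∀ k (s t : ℝ), |s| ≤ B' → |t| ≤ B' → |a k * s + b k * t| ≤ (C + 1) * B' * b k := by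
    intro k s t hs ht
    calc |a k * s + b k * t| ≤ |a k * s| + |b k * t| := abs_add_le _ _
      _ = a k * |s| + b k * |t| := by rw [abs_mul, abs_mul, abs_of_nonneg (ha k), abs_of_nonneg (hb k)]
      _ ≤ a k * B' + b k * B' := by
          gcongr
          · exact ha k
          · exact hb k
      _ ≤ (C * b k) * B' + b k * B' := by gcongr; exact hab k
      _ = _ := by ring
  let Q : ℕ → Ω → Matrix ι ι ℝ := fun k ω => Matrix.of fun i j => a k * VD k i j ω + b k * VL k i j ω
  let F : ℕ → Ω → Matrix ι ι ℝ := fun k ω => Matrix.of fun i j =>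
    (a k * UD i j (ℓ k ω) + b k * UL i j (ℓ k ω)) - (a k * VD k i j ω + b k * VL k i j ω)
  have hVDm : ∀ k i j, StronglyMeasurable[ℱ k] (VD k i j) := fun k i j => stronglyMeasurable_condExp
  have hVLm : ∀ k i j, StronglyMeasurable[ℱ k] (VL k i j) := fun k i j => stronglyMeasurable_condExp
  have hQadp : ∀ k i j, StronglyMeasurable[ℱ k] fun ω => Q k ω i j := fun k i j =>
    ((hVDm k i j).const_mul (a k)).add ((hVLm k i j).const_mul (b k))
  refine tendsto_zero_of_linear_recursion (C := (C + 1) * B') ℱ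
    (G := fun k ω => a k • D (ℓ k ω) + b k • L (ℓ k ω)) (F := F) (Q := Q)
    (δ := fun k => B' * ((a k - a (k + 1)) + (b k - b (k + 1))))
    (by positivity) hb hbanti hblim hbs hα hαd
    (fun k => mul_nonneg hB'0 (add_nonneg (sub_nonneg.2 (haanti k.le_succ))
      (sub_nonneg.2 (hbanti k.le_succ))))
    (((summable_sub_succ_of_antitone ha haanti).add
      (summable_sub_succ_of_antitone hb hbanti)).mul_left B') hη hηs hrec
    (fun k ω i j => hlin k _ _ ((hD _ i j).trans hBB') ((hL _ i j).trans hBB')) hcoer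
    ?_ ?_ ?_ he_adp hQadp ?_ ?_ he0 hwL2 ?_ hwc hw2
  · intro k
    filter_upwards [hVD k, hVL k] with ω h1 h2 i j
    exact hlin k _ _ (h1 i j) (h2 i j)
  · intro k i j
    refine ⟨(C + 1) * B' * b k + (C + 1) * B' * b k, ?_⟩
    filter_upwards [hVD k, hVL k] with ω h1 h2
    exact (abs_sub _ _).trans (add_le_add (hlin k _ _ (hUDB i j _) (hULB i j _))
      (hlin k _ _ (h1 i j) (h2 i j)))
  · intro k
    have hpD : ∀ᵐ ω ∂μ, ∀ i j, VD (k + 1) i j ω = ∑' l, P (ℓ k ω) l * UD i j l :=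
      ae_all_iff.2 fun i => ae_all_iff.2 fun j =>
        condExp_comp_markov (ℱ.le _) (hℓ k) (hℓ (k + 1)) hP hPs (hMarkov k) (hUDB i j)
    have hpL : ∀ᵐ ω ∂μ, ∀ i j, VL (k + 1) i j ω = ∑' l, P (ℓ k ω) l * UL i j l :=
      ae_all_iff.2 fun i => ae_all_iff.2 fun j =>
        condExp_comp_markov (ℱ.le _) (hℓ k) (hℓ (k + 1)) hP hPs (hMarkov k) (hULB i j)
    filter_upwards [hVD (k + 1), hVL (k + 1), hpD, hpL] with ω h1 h2 h3 h4 i j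
    have e1 := hUDp i j (ℓ k ω)
    have e2 := hULp i j (ℓ k ω)
    rw [← h3 i j] at e1
    rw [← h4 i j] at e2
    have key : (a k • D (ℓ k ω) + b k • L (ℓ k ω) - (a k • Matrix.of (fun i j => ∑' l, ϖ l * D l i j)
        + b k • Matrix.of (fun i j => ∑' l, ϖ l * L l i j) + F k ω + Q k ω - Q (k + 1) ω)) i j
        = -((a k - a (k + 1)) * VD (k + 1) i j ω + (b k - b (k + 1)) * VL (k + 1) i j ω) := by
      simp only [Matrix.sub_apply, Matrix.add_apply, Matrix.smul_apply, Matrix.of_apply, F, Q,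
        smul_eq_mul]
      linear_combination (-a k) * e1 - b k * e2
    rw [key, abs_neg]
    have ha' := sub_nonneg.2 (haanti k.le_succ)
    have hb' := sub_nonneg.2 (hbanti k.le_succ)
    calc _ ≤ |(a k - a (k + 1)) * VD (k + 1) i j ω| + |(b k - b (k + 1)) * VL (k + 1) i j ω| :=
          abs_add_le _ _
      _ = (a k - a (k + 1)) * |VD (k + 1) i j ω| + (b k - b (k + 1)) * |VL (k + 1) i j ω| := by
          rw [abs_mul, abs_mul, abs_of_nonneg ha', abs_of_nonneg hb']
      _ ≤ (a k - a (k + 1)) * B' + (b k - b (k + 1)) * B' :=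
          add_le_add (mul_le_mul_of_nonneg_left (h1 i j) ha')
            (mul_le_mul_of_nonneg_left (h2 i j) hb')
      _ = _ := by ring
  · exact fun k i j => (((hcomp (fun l => D l i j) k).const_mul (a k)).add
      ((hcomp (fun l => L l i j) k).const_mul (b k))).aestronglyMeasurable
  · exact fun k i j => ((((hcomp (UD i j) k).const_mul (a k)).add
      ((hcomp (UL i j) k).const_mul (b k))).sub ((hQadp k i j).mono (ℱ.le k))).aestronglyMeasurable
  · intro k i j
    have hi1 := (hUDint k i j).const_mul (a k)
    have hi2 := (hULint k i j).const_mul (b k)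
    have hq : Integrable (fun ω => Q k ω i j) μ :=
      (integrable_condExp.const_mul (a k)).add (integrable_condExp.const_mul (b k))
    have c1 := condExp_sub (hi1.add hi2) hq (ℱ k)
    have c2 := condExp_add hi1 hi2 (ℱ k)
    have c3 := condExp_smul (μ := μ) (a k) (fun ω => UD i j (ℓ k ω)) (ℱ k)
    have c4 := condExp_smul (μ := μ) (b k) (fun ω => UL i j (ℓ k ω)) (ℱ k)
    have c5 := condExp_of_stronglyMeasurable (ℱ.le k) (hQadp k i j) hq
    rw [c5] at c1
    filter_upwards [c1, c2, c3, c4] with ω h1 h2 h3 h4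
    refine h1.trans ?_
    rw [Pi.sub_apply, h2, Pi.add_apply]
    refine sub_eq_zero.2 ?_
    exact congrArg₂ (· + ·) h3 h4

lemma sup_eq_generateFrom_inter {Ω : Type*} (m₁ m₂ : MeasurableSpace Ω) :
    m₁ ⊔ m₂ = MeasurableSpace.generateFrom
      {s | ∃ s₁ s₂, MeasurableSet[m₁] s₁ ∧ MeasurableSet[m₂] s₂ ∧ s = s₁ ∩ s₂} := by
  refine le_antisymm (sup_le (fun s hs => ?_) fun s hs => ?_)
    (MeasurableSpace.generateFrom_le ?_)
  · exact MeasurableSpace.measurableSet_generateFrom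
      ⟨s, Set.univ, hs, MeasurableSet.univ, (Set.inter_univ s).symm⟩
  · exact MeasurableSpace.measurableSet_generateFrom
      ⟨Set.univ, s, MeasurableSet.univ, hs, (Set.univ_inter s).symm⟩
  · rintro s ⟨s₁, s₂, h₁, h₂, rfl⟩
    exact MeasurableSet.inter ((le_sup_left : m₁ ≤ m₁ ⊔ m₂) _ h₁)
      ((le_sup_right : m₂ ≤ m₁ ⊔ m₂) _ h₂)

lemma setIntegral_eq_zero_of_pi_system {Ω : Type*} {m m0 : MeasurableSpace Ω} {μ : Measure Ω}
    (hm : m ≤ m0) {π : Set (Set Ω)} (hmπ : m = MeasurableSpace.generateFrom π)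
    (hπ : IsPiSystem π) {X : Ω → ℝ} (hX : Integrable X μ) (huniv : ∫ ω, X ω ∂μ = 0)
    (h : ∀ s ∈ π, ∫ ω in s, X ω ∂μ = 0) {s : Set Ω} (hs : MeasurableSet[m] s) :
    ∫ ω in s, X ω ∂μ = 0 := by
  induction s, hs using MeasurableSpace.induction_on_inter hmπ hπ with
  | empty => simp
  | basic t ht => exact h t ht
  | compl t ht ih =>
    have := integral_add_compl (hm _ ht) hX
    rw [ih, huniv, zero_add] at this
    exact this
  | iUnion f hd hf ih =>
    rw [integral_iUnion (fun i => hm _ (hf i)) hd hX.integrableOn]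
    simp [ih]

/-- A variable centred given `m'` stays centred when an independent σ-algebra is adjoined. -/
theorem condExp_sup_eq_zero_of_indep {Ω : Type*} {m' m₁ m₂ m0 : MeasurableSpace Ω}
    {μ : Measure Ω} [IsProbabilityMeasure μ] (hm' : m' ≤ m₁) (hm₁ : m₁ ≤ m0) (hm₂ : m₂ ≤ m0)
    (hind : ProbabilityTheory.Indep m₁ m₂ μ) {X : Ω → ℝ} (hXm : StronglyMeasurable[m₁] X)
    (hX : Integrable X μ) (h0 : μ[X|m'] =ᵐ[μ] 0) : μ[X|m' ⊔ m₂] =ᵐ[μ] 0 := by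
  have hset : ∀ s, MeasurableSet[m'] s → ∫ ω in s, X ω ∂μ = 0 := fun s hs => by
    rw [← setIntegral_condExp (hm'.trans hm₁) hX hs, integral_congr_ae (ae_restrict_of_ae h0)]
    simp
  have huniv : ∫ ω, X ω ∂μ = 0 := by
    simpa using hset Set.univ MeasurableSet.univ
  have hsup : m' ⊔ m₂ ≤ m0 := sup_le (hm'.trans hm₁) hm₂
  refine (ae_eq_condExp_of_forall_setIntegral_eq hsup hX (fun _ _ _ => integrableOn_zero)
    (fun s hs _ => ?_) aestronglyMeasurable_zero).symm
  have hz : ∫ ω in s, X ω ∂μ = 0 := by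
    refine setIntegral_eq_zero_of_pi_system hsup (sup_eq_generateFrom_inter m' m₂) ?_ hX huniv ?_ hs
    · rintro _ ⟨s₁, s₂, h₁, h₂, rfl⟩ _ ⟨t₁, t₂, k₁, k₂, rfl⟩ -
      exact ⟨s₁ ∩ t₁, s₂ ∩ t₂, h₁.inter k₁, h₂.inter k₂, Set.inter_inter_inter_comm _ _ _ _⟩
    · rintro _ ⟨s₁, s₂, h₁, h₂, rfl⟩
      have h1 : ∫ ω in s₂, s₁.indicator X ω ∂μ = μ.real s₂ * ∫ ω, s₁.indicator X ω ∂μ := by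
        have hY : StronglyMeasurable[m₁] (s₁.indicator X) := hXm.indicator (hm' _ h₁)
        exact ProbabilityTheory.Indep.setIntegral_eq_mul (f := id) hm₂
          (ProbabilityTheory.indep_of_indep_of_le_right hind.symm hY.measurable.comap_le)
          (hY.mono hm₁).measurable.aemeasurable h₂ aestronglyMeasurable_id
      rw [setIntegral_indicator (hm₁ _ (hm' _ h₁)), integral_indicator (hm₁ _ (hm' _ h₁)),
        hset s₁ h₁, mul_zero, Set.inter_comm] at h1
      exact h1
  simp [hz]

/-- A matrix with positive definite quadratic form dominates a multiple of the identity. -/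
lemma exists_pos_mul_dotProduct_le {ι : Type*} [Fintype ι] (M : Matrix ι ι ℝ)
    (hM : ∀ e : ι → ℝ, e ≠ 0 → 0 < e ⬝ᵥ M *ᵥ e) :
    ∃ c : ℝ, 0 < c ∧ ∀ e : ι → ℝ, c * (e ⬝ᵥ e) ≤ e ⬝ᵥ M *ᵥ e := by
  by_cases hS : (Metric.sphere (0 : ι → ℝ) 1).Nonempty
  · have hcont : Continuous fun e : ι → ℝ => e ⬝ᵥ M *ᵥ e :=
      continuous_id.dotProduct (continuous_const.matrix_mulVec continuous_id)
    obtain ⟨e₀, he₀, hmin⟩ := (isCompact_sphere (0 : ι → ℝ) 1).exists_isMinOn hS hcont.continuousOn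
    have he₀0 : e₀ ≠ 0 := by
      rintro rfl
      simp at he₀
    have hc₀ := hM e₀ he₀0
    have hcard : (0 : ℝ) < Fintype.card ι + 1 := by positivity
    refine ⟨(e₀ ⬝ᵥ M *ᵥ e₀) / (Fintype.card ι + 1), by positivity, fun e => ?_⟩
    rcases eq_or_ne e 0 with rfl | he
    · simp
    have hnorm : ‖e‖ ≠ 0 := norm_ne_zero_iff.2 he
    have h1 : e₀ ⬝ᵥ M *ᵥ e₀ ≤ (‖e‖⁻¹ • e) ⬝ᵥ M *ᵥ (‖e‖⁻¹ • e) :=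
      hmin (by simp [norm_smul, hnorm])
    rw [mulVec_smul, smul_dotProduct, dotProduct_smul, smul_eq_mul, smul_eq_mul] at h1
    have h2 : (e₀ ⬝ᵥ M *ᵥ e₀) * ‖e‖ ^ 2 ≤ e ⬝ᵥ M *ᵥ e := by
      calc _ ≤ (‖e‖⁻¹ * (‖e‖⁻¹ * (e ⬝ᵥ M *ᵥ e))) * ‖e‖ ^ 2 := by gcongr
        _ = _ := by field_simp
    have h3 : e ⬝ᵥ e ≤ (Fintype.card ι + 1) * ‖e‖ ^ 2 := by
      calc e ⬝ᵥ e ≤ ∑ _i : ι, ‖e‖ ^ 2 := Finset.sum_le_sum fun i _ => by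
            rw [← sq, ← sq_abs]
            exact pow_le_pow_left₀ (abs_nonneg _) (norm_le_pi_norm e i) 2
        _ = Fintype.card ι * ‖e‖ ^ 2 := by simp
        _ ≤ _ := by nlinarith [sq_nonneg ‖e‖]
    calc _ ≤ (e₀ ⬝ᵥ M *ᵥ e₀) / (Fintype.card ι + 1) * ((Fintype.card ι + 1) * ‖e‖ ^ 2) := by
          gcongr
      _ = (e₀ ⬝ᵥ M *ᵥ e₀) * ‖e‖ ^ 2 := by field_simp
      _ ≤ _ := h2
  · refine ⟨1, one_pos, fun e => ?_⟩
    have : e = 0 := by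
      by_contra he
      exact hS ⟨‖e‖⁻¹ • e, by simp [norm_smul, norm_ne_zero_iff.2 he]⟩
    simp [this]

/-- The block diagonal matrix with blocks `K i`, indexed by pairs (node, coordinate). -/
def nodeBlock {V κ : Type*} [DecidableEq V] (K : V → Matrix κ κ ℝ) : Matrix (V × κ) (V × κ) ℝ :=
  Matrix.of fun s t => if s.1 = t.1 then K s.1 s.2 t.2 else 0

/-- The graph Laplacian of a weighted adjacency matrix acting on each coordinate separately. -/
def nodeLaplacian {V κ : Type*} [Fintype V] [DecidableEq V] [DecidableEq κ]
    (W : Matrix V V ℝ) : Matrix (V × κ) (V × κ) ℝ :=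
  Matrix.of fun s t =>
    if s.2 = t.2 then (if s.1 = t.1 then ∑ k, W s.1 k else 0) - W s.1 t.1 else 0

section

variable {V κ : Type*} [Fintype V] [Fintype κ] [DecidableEq V]

lemma nodeBlock_mulVec (K : V → Matrix κ κ ℝ) (e : V × κ → ℝ) (i : V) (c : κ) :
    (nodeBlock K *ᵥ e) (i, c) = (K i *ᵥ fun c' => e (i, c')) c := by
  simp [nodeBlock, mulVec, dotProduct, Fintype.sum_prod_type, ite_mul]

lemma nodeLaplacian_mulVec [DecidableEq κ] (W : Matrix V V ℝ) (e : V × κ → ℝ) (i : V) (c : κ) :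
    (nodeLaplacian W *ᵥ e) (i, c) = ∑ j, W i j * (e (i, c) - e (j, c)) := by
  simp only [nodeLaplacian, mulVec, dotProduct, Fintype.sum_prod_type, of_apply, ite_mul, zero_mul,
    Finset.sum_ite_eq, Finset.mem_univ, if_true, sub_mul, Finset.sum_sub_distrib, mul_sub,
    Finset.sum_mul]

lemma dotProduct_nodeBlock (K : V → Matrix κ κ ℝ) (e : V × κ → ℝ) :
    e ⬝ᵥ nodeBlock K *ᵥ e = ∑ i, (fun c => e (i, c)) ⬝ᵥ K i *ᵥ fun c => e (i, c) := by
  simp only [dotProduct, Fintype.sum_prod_type, nodeBlock_mulVec]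

lemma dotProduct_nodeLaplacian [DecidableEq κ] {W : Matrix V V ℝ}
    (hbal : ∀ i, ∑ j, W i j = ∑ j, W j i) (e : V × κ → ℝ) :
    e ⬝ᵥ nodeLaplacian W *ᵥ e
      = ∑ c, ∑ i, ∑ j, W i j * (e (i, c) - e (j, c)) ^ 2 / 2 := by
  simp only [dotProduct, Fintype.sum_prod_type, nodeLaplacian_mulVec]
  rw [Finset.sum_comm]
  refine Finset.sum_congr rfl fun c _ => ?_
  have h : ∑ i, ∑ j, W i j * e (j, c) ^ 2 = ∑ i, ∑ j, W i j * e (i, c) ^ 2 := by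
    rw [Finset.sum_comm]
    refine Finset.sum_congr rfl fun j _ => ?_
    rw [← Finset.sum_mul, ← Finset.sum_mul, hbal]
  have h2 : ∀ i j, W i j * (e (i, c) - e (j, c)) ^ 2 / 2
      = e (i, c) * (W i j * (e (i, c) - e (j, c)))
        + (W i j * e (j, c) ^ 2 - W i j * e (i, c) ^ 2) / 2 := fun i j => by ring
  simp only [h2, Finset.sum_add_distrib, ← Finset.sum_div, Finset.sum_sub_distrib, h, sub_self,
    zero_div, add_zero, Finset.mul_sum]

/-- Joint observability together with a balanced graph containing a spanning tree makes the
sum of the observation form and the consensus form positive definite. -/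
theorem dotProduct_nodeBlock_add_nodeLaplacian_pos [DecidableEq κ] {W : Matrix V V ℝ}
    (hW : ∀ i j, 0 ≤ W i j) (hbal : ∀ i, ∑ j, W i j = ∑ j, W j i)
    (htree : ∃ root, ∀ i, Relation.ReflTransGen (fun u w => 0 < W w u) root i)
    {K : V → Matrix κ κ ℝ} (hK : ∀ i u, 0 ≤ u ⬝ᵥ K i *ᵥ u)
    (hKpos : ∀ u : κ → ℝ, u ≠ 0 → 0 < ∑ i, u ⬝ᵥ K i *ᵥ u) (e : V × κ → ℝ) (he : e ≠ 0) :
    0 < e ⬝ᵥ (nodeBlock K + nodeLaplacian W) *ᵥ e := by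
  rw [add_mulVec, dotProduct_add, dotProduct_nodeBlock, dotProduct_nodeLaplacian hbal]
  have hD : 0 ≤ ∑ i, (fun c => e (i, c)) ⬝ᵥ K i *ᵥ fun c => e (i, c) :=
    Finset.sum_nonneg fun i _ => hK i _
  have hterm : ∀ c i j, 0 ≤ W i j * (e (i, c) - e (j, c)) ^ 2 / 2 := fun c i j =>
    div_nonneg (mul_nonneg (hW i j) (sq_nonneg _)) two_pos.le
  have hL : 0 ≤ ∑ c, ∑ i, ∑ j, W i j * (e (i, c) - e (j, c)) ^ 2 / 2 :=
    Finset.sum_nonneg fun c _ => Finset.sum_nonneg fun i _ => Finset.sum_nonneg fun j _ =>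
      hterm c i j
  by_contra hneg
  have hL0 : ∑ c, ∑ i, ∑ j, W i j * (e (i, c) - e (j, c)) ^ 2 / 2 = 0 := by linarith
  have hD0 : ∑ i, (fun c => e (i, c)) ⬝ᵥ K i *ᵥ (fun c => e (i, c)) = 0 := by linarith
  have hedge : ∀ u w, 0 < W w u → (fun c => e (w, c)) = fun c => e (u, c) := by
    intro u w huw
    ext c
    have h1 := (Finset.sum_eq_zero_iff_of_nonneg fun c _ => Finset.sum_nonneg fun i _ =>
      Finset.sum_nonneg fun j _ => hterm c i j).1 hL0 c (Finset.mem_univ _)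
    have h2 := (Finset.sum_eq_zero_iff_of_nonneg fun i _ =>
      Finset.sum_nonneg fun j _ => hterm c i j).1 h1 w (Finset.mem_univ _)
    have h3 := (Finset.sum_eq_zero_iff_of_nonneg fun j _ => hterm c w j).1 h2 u (Finset.mem_univ _)
    have h4 : (e (w, c) - e (u, c)) ^ 2 = 0 := by
      by_contra h5
      have : 0 < W w u * (e (w, c) - e (u, c)) ^ 2 :=
        mul_pos huw (lt_of_le_of_ne (sq_nonneg _) (Ne.symm h5))
      linarith
    exact sub_eq_zero.1 (pow_eq_zero_iff two_ne_zero |>.1 h4)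
  obtain ⟨root, hroot⟩ := htree
  have hall : ∀ i, (fun c => e (i, c)) = fun c => e (root, c) := fun i => by
    induction hroot i with
    | refl => rfl
    | tail _ h ih => exact (hedge _ _ h).trans ih
  simp only [hall] at hD0
  have hu : (fun c => e (root, c)) = 0 := by
    by_contra hu
    exact (hKpos _ hu).ne' hD0
  exact he (funext fun s => by simpa using (congrFun (hall s.1) s.2).trans (congrFun hu s.2))

/-- Coercivity of the averaged gain matrix when the observation gain `a` is dominated by `C * b`. -/
theorem exists_pos_mul_dotProduct_le_gain [DecidableEq κ] {W : Matrix V V ℝ}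
    (hW : ∀ i j, 0 ≤ W i j) (hbal : ∀ i, ∑ j, W i j = ∑ j, W j i)
    (htree : ∃ root, ∀ i, Relation.ReflTransGen (fun u w => 0 < W w u) root i)
    {K : V → Matrix κ κ ℝ} (hK : ∀ i u, 0 ≤ u ⬝ᵥ K i *ᵥ u)
    (hKpos : ∀ u : κ → ℝ, u ≠ 0 → 0 < ∑ i, u ⬝ᵥ K i *ᵥ u) {C : ℝ} (hC : 1 ≤ C) :
    ∃ c : ℝ, 0 < c ∧ ∀ (a b : ℝ), 0 ≤ a → a ≤ C * b → ∀ e : V × κ → ℝ,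
      c * a * (e ⬝ᵥ e) ≤ e ⬝ᵥ (a • nodeBlock K + b • nodeLaplacian W) *ᵥ e := by
  obtain ⟨c, hc, hce⟩ := exists_pos_mul_dotProduct_le _
    (dotProduct_nodeBlock_add_nodeLaplacian_pos hW hbal htree hK hKpos)
  have hC0 : 0 < C := one_pos.trans_le hC
  refine ⟨c / C, by positivity, fun a b ha hab e => ?_⟩
  have h := hce e
  rw [add_mulVec, dotProduct_add] at h
  rw [add_mulVec, dotProduct_add, smul_mulVec, smul_mulVec, dotProduct_smul, dotProduct_smul,
    smul_eq_mul, smul_eq_mul]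
  have hD : 0 ≤ e ⬝ᵥ nodeBlock K *ᵥ e := by
    rw [dotProduct_nodeBlock]
    exact Finset.sum_nonneg fun i _ => hK i _
  have hL : 0 ≤ e ⬝ᵥ nodeLaplacian W *ᵥ e := by
    rw [dotProduct_nodeLaplacian hbal]
    exact Finset.sum_nonneg fun c _ => Finset.sum_nonneg fun i _ => Finset.sum_nonneg fun j _ =>
      div_nonneg (mul_nonneg (hW i j) (sq_nonneg _)) two_pos.le
  have haC : a / C ≤ b := (div_le_iff₀' hC0).2 hab
  have haC' : a / C ≤ a := div_le_self ha hC
  calc c / C * a * (e ⬝ᵥ e) = a / C * (c * (e ⬝ᵥ e)) := by ring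
    _ ≤ a / C * (e ⬝ᵥ nodeBlock K *ᵥ e + e ⬝ᵥ nodeLaplacian W *ᵥ e) := by gcongr
    _ = a / C * (e ⬝ᵥ nodeBlock K *ᵥ e) + a / C * (e ⬝ᵥ nodeLaplacian W *ᵥ e) := by ring
    _ ≤ _ := by gcongr

end

lemma tsum_nodeBlock {V κ : Type*} [DecidableEq V] (ϖ : ℕ → ℝ) (K : ℕ → V → Matrix κ κ ℝ) :
    (Matrix.of fun s t => ∑' l, ϖ l * nodeBlock (K l) s t)
      = nodeBlock fun i => Matrix.of fun c d => ∑' l, ϖ l * K l i c d := by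
  ext s t
  by_cases h : s.1 = t.1 <;> simp [nodeBlock, h]

lemma tsum_nodeLaplacian {V κ : Type*} [Fintype V] [DecidableEq V] [DecidableEq κ] {ϖ : ℕ → ℝ}
    (hϖ : ∀ l, 0 ≤ ϖ l) (hϖs : Summable ϖ) {W : ℕ → Matrix V V ℝ} {B : ℝ}
    (hW : ∀ l i j, |W l i j| ≤ B) :
    (Matrix.of fun s t : V × κ => ∑' l, ϖ l * nodeLaplacian (W l) s t)
      = nodeLaplacian (Matrix.of fun i j => ∑' l, ϖ l * W l i j) := by
  have hs : ∀ i j, Summable fun l => ϖ l * W l i j := fun i j =>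
    summable_mul_of_abs_le hϖ hϖs fun l => hW l i j
  ext s t
  by_cases h2 : s.2 = t.2 <;> by_cases h1 : s.1 = t.1 <;>
    simp only [nodeLaplacian, of_apply, h1, h2, if_true, if_false, mul_zero, tsum_zero, mul_sub,
      Finset.mul_sum, zero_sub, mul_neg, tsum_neg]
  rw [Summable.tsum_sub (summable_sum fun k _ => hs _ k) (hs _ _),
    Summable.tsum_finsetSum fun k _ => hs _ k]

lemma hasSum_dotProduct_mulVec {κ : Type*} [Fintype κ] {ϖ : ℕ → ℝ} {K : ℕ → Matrix κ κ ℝ}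
    (hs : ∀ c d, Summable fun l => ϖ l * K l c d) (u : κ → ℝ) :
    HasSum (fun l => ϖ l * (u ⬝ᵥ K l *ᵥ u))
      (u ⬝ᵥ (Matrix.of fun c d => ∑' l, ϖ l * K l c d) *ᵥ u) := by
  have h : HasSum (fun l => ∑ c, u c * ∑ d, ϖ l * K l c d * u d)
      (∑ c, u c * ∑ d, (∑' l, ϖ l * K l c d) * u d) :=
    hasSum_sum fun c _ => (hasSum_sum fun d _ => (hs c d).hasSum.mul_right (u d)).mul_left (u c)
  have hl : ∀ l, ϖ l * (u ⬝ᵥ K l *ᵥ u) = ∑ c, u c * ∑ d, ϖ l * K l c d * u d := fun l => by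
    simp only [dotProduct, mulVec, Finset.mul_sum]
    exact Finset.sum_congr rfl fun c _ => Finset.sum_congr rfl fun d _ => by ring
  rw [funext hl]
  exact h

lemma dotProduct_transpose_mul_self_nonneg {p q : Type*} [Fintype p] [Fintype q]
    (M : Matrix p q ℝ) (u : q → ℝ) : 0 ≤ u ⬝ᵥ (Mᵀ * M) *ᵥ u := by
  rw [← mulVec_mulVec, dotProduct_mulVec, vecMul_transpose]
  exact Finset.sum_nonneg fun _ _ => mul_self_nonneg _

lemma abs_transpose_mul_self_le {p q : Type*} [Fintype p] {M : Matrix p q ℝ} {B : ℝ}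
    (hM : ∀ i j, |M i j| ≤ B) (c d : q) : |(Mᵀ * M) c d| ≤ Fintype.card p * B ^ 2 := by
  calc |(Mᵀ * M) c d| ≤ ∑ i, |M i c * M i d| := Finset.abs_sum_le_sum_abs _ _
    _ ≤ ∑ _i : p, B ^ 2 := Finset.sum_le_sum fun i _ => by
        rw [abs_mul, sq]
        exact mul_le_mul (hM i c) (hM i d) (abs_nonneg _) ((abs_nonneg _).trans (hM i c))
    _ = _ := by simp

lemma abs_nodeBlock_le {V κ : Type*} [DecidableEq V] {K : V → Matrix κ κ ℝ} {B : ℝ} (hB : 0 ≤ B)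
    (hK : ∀ i c d, |K i c d| ≤ B) (s t : V × κ) : |nodeBlock K s t| ≤ B := by
  simp only [nodeBlock, of_apply]
  split_ifs
  · exact hK _ _ _
  · simpa using hB

lemma abs_nodeLaplacian_le {V κ : Type*} [Fintype V] [DecidableEq V] [DecidableEq κ]
    {W : Matrix V V ℝ} {B : ℝ} (hB : 0 ≤ B) (hW : ∀ i j, |W i j| ≤ B) (s t : V × κ) :
    |nodeLaplacian W s t| ≤ (Fintype.card V + 1) * B := by
  simp only [nodeLaplacian, of_apply]
  have hrow : |∑ k, W s.1 k| ≤ Fintype.card V * B :=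
    (Finset.abs_sum_le_sum_abs _ _).trans
      ((Finset.sum_le_sum fun k _ => hW s.1 k).trans (by simp))
  split_ifs
  · refine (abs_sub _ _).trans ?_
    linarith [hW s.1 t.1]
  · rw [zero_sub, abs_neg, add_mul, one_mul]
    exact (hW _ _).trans (le_add_of_nonneg_left (by positivity))
  · simp only [abs_zero]
    positivity

/-- Squared length of `Mᵀ u` for a matrix with bounded entries. -/
lemma transpose_mulVec_sq_le {p q : Type*} [Fintype p] {M : Matrix p q ℝ} {B : ℝ}
    (hM : ∀ i j, |M i j| ≤ B) (u : p → ℝ) (c : q) :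
    ((Mᵀ *ᵥ u) c) ^ 2 ≤ Fintype.card p * B ^ 2 * ∑ i, u i ^ 2 := by
  refine (Finset.sum_mul_sq_le_sq_mul_sq Finset.univ (fun i => M i c) u).trans ?_
  refine mul_le_mul_of_nonneg_right ?_ (Finset.sum_nonneg fun i _ => sq_nonneg _)
  calc ∑ i, M i c ^ 2 ≤ ∑ _i : p, B ^ 2 := Finset.sum_le_sum fun i _ => by
        rw [← sq_abs]
        exact pow_le_pow_left₀ (abs_nonneg _) (hM i c) 2
    _ = _ := by simp

lemma abs_entry_le_specNorm {p q : Type*} [Fintype p] [Fintype q] [DecidableEq q]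
    (M : Matrix p q ℝ) (i : p) (j : q) : |M i j| ≤ specNorm M := by
  have h := (LinearMap.toContinuousLinearMap (Matrix.toEuclideanLin M)).le_opNorm
    (EuclideanSpace.single j (1 : ℝ))
  have h2 := PiLp.norm_apply_le
    ((LinearMap.toContinuousLinearMap (Matrix.toEuclideanLin M)) (EuclideanSpace.single j (1 : ℝ))) i
  simp only [LinearMap.coe_toContinuousLinearMap', PiLp.norm_single, norm_one, mul_one]
    at h h2
  refine le_trans (le_of_eq ?_) (h2.trans h)
  simp [Matrix.toLpLin_apply]

lemma abs_entry_le_specNorm_blockH {N n : ℕ} {ni : Fin N → ℕ}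
    (H : ∀ i : Fin N, Matrix (Fin (ni i)) (Fin n) ℝ) (i : Fin N) (p : Fin (ni i)) (c : Fin n) :
    |H i p c| ≤ specNorm (blockH H) := by
  simpa [blockH] using abs_entry_le_specNorm (blockH H) ⟨i, p⟩ (i, c)

lemma measurable_apply_of_pi {Ω κ : Type*} {X : κ → Type*} {m : MeasurableSpace Ω}
    [∀ a, MeasurableSpace (X a)] {f : Ω → ∀ a, X a} (hf : Measurable f) (a : κ) :
    Measurable fun ω => f ω a :=
  hf.eval

section

variable {Ω : Type*} {N n : ℕ} {ni : Fin N → ℕ}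
  {H : ℕ → ∀ i : Fin N, Ω → Matrix (Fin (ni i)) (Fin n) ℝ}
  {v : ℕ → Ω → ∀ i : Fin N, Fin (ni i) → ℝ} {A : ℕ → Ω → Matrix (Fin N) (Fin N) ℝ}

lemma sigBefore_mono : Monotone (sigBefore H v A) := fun _ _ hjk =>
  iSup₂_le fun s hs => le_iSup₂_of_le s (hs.trans_le hjk) le_rfl

lemma sigBefore_le {m0 : MeasurableSpace Ω}
    (hH : ∀ k, Measurable fun ω (i : Fin N) (p : Fin (ni i)) (c : Fin n) => H k i ω p c)
    (hv : ∀ k, Measurable (v k)) (hA : ∀ k, Measurable fun ω (i j : Fin N) => A k ω i j) (k : ℕ) :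
    sigBefore H v A k ≤ m0 :=
  iSup₂_le fun s _ => sup_le (sup_le (hH s).comap_le (hv s).comap_le) (hA s).comap_le

lemma measurable_obs_sigBefore {s k : ℕ} (hs : s < k) (i : Fin N) (p : Fin (ni i)) (c : Fin n) :
    Measurable[sigBefore H v A k] fun ω => H s i ω p c := by
  have h : Measurable[sigBefore H v A k]
      fun ω (i : Fin N) (p : Fin (ni i)) (c : Fin n) => H s i ω p c :=
    measurable_iff_comap_le.2 ((le_sup_left.trans le_sup_left).trans
      (le_iSup₂_of_le s hs le_rfl))
  exact measurable_apply_of_pi (measurable_apply_of_pi (measurable_apply_of_pi h i) p) c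

lemma measurable_noise_sigBefore {s k : ℕ} (hs : s < k) (i : Fin N) (p : Fin (ni i)) :
    Measurable[sigBefore H v A k] fun ω => v s ω i p := by
  have h : Measurable[sigBefore H v A k] (v s) :=
    measurable_iff_comap_le.2 ((le_sup_right.trans le_sup_left).trans
      (le_iSup₂_of_le s hs le_rfl))
  exact measurable_apply_of_pi (measurable_apply_of_pi h i) p

lemma measurable_weight_sigBefore {s k : ℕ} (hs : s < k) (i j : Fin N) :
    Measurable[sigBefore H v A k] fun ω => A s ω i j := by
  have h : Measurable[sigBefore H v A k] fun ω (i j : Fin N) => A s ω i j :=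
    measurable_iff_comap_le.2 (le_sup_right.trans (le_iSup₂_of_le s hs le_rfl))
  exact measurable_apply_of_pi (measurable_apply_of_pi h i) j

lemma measurable_estimate_step {m : MeasurableSpace Ω} {k : ℕ} {x : Fin N → Ω → Fin n → ℝ}
    (x0 : Fin n → ℝ) (a b : ℝ) {i : Fin N} (hH : ∀ p c, Measurable fun ω => H k i ω p c)
    (hv : ∀ p, Measurable fun ω => v k ω i p) (hA : ∀ j, Measurable fun ω => A k ω i j)
    (hx : ∀ i c, Measurable fun ω => x i ω c) (c : Fin n) :
    Measurable fun ω => x i ω c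
      + a * ((H k i ω)ᵀ.mulVec
          (((H k i ω).mulVec x0 + v k ω i) - (H k i ω).mulVec (x i ω))) c
      + b * ∑ j, A k ω i j * (x j ω c - x i ω c) := by
  simp only [mulVec, dotProduct, transpose_apply, Pi.add_apply, Pi.sub_apply]
  refine ((hx i c).add (Measurable.const_mul ?_ a)).add (Measurable.const_mul ?_ b)
  · refine Finset.measurable_fun_sum _ fun p _ => (hH p c).mul (Measurable.sub ?_ ?_)
    · exact (Finset.measurable_fun_sum _ fun d _ => (hH p d).mul_const _).add (hv p)
    · exact Finset.measurable_fun_sum _ fun d _ => (hH p d).mul (hx i d)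
  · exact Finset.measurable_fun_sum _ fun j _ => (hA j).mul ((hx j c).sub (hx i c))

/-- The noise, weighted by the current observation matrix, is still centred given the past. -/
theorem condExp_obs_mul_noise_eq_zero [m0 : MeasurableSpace Ω] {μ : Measure Ω}
    [IsProbabilityMeasure μ]
    (hH : ∀ k, Measurable fun ω (i : Fin N) (p : Fin (ni i)) (c : Fin n) => H k i ω p c)
    (hv : ∀ k, Measurable (v k)) (hA : ∀ k, Measurable fun ω (i j : Fin N) => A k ω i j)
    (hindep : ProbabilityTheory.IndepFun (fun ω => fun k => v k ω)
      (fun ω => fun k => ((fun (i : Fin N) (p : Fin (ni i)) (c : Fin n) => H k i ω p c),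
        (fun (i j : Fin N) => A k ω i j))) μ)
    {k : ℕ} {i : Fin N} {p : Fin (ni i)} {B : ℝ} {c : Fin n} (hB : ∀ ω, |H k i ω p c| ≤ B)
    (hInt : Integrable (fun ω => v k ω i p) μ)
    (h0 : μ[fun ω => v k ω i p|sigBefore H v A k] =ᵐ[μ] 0) :
    μ[fun ω => H k i ω p c * v k ω i p|sigBefore H v A k] =ᵐ[μ] 0 := by
  let HA : Ω → ℕ → (∀ i : Fin N, Fin (ni i) → Fin n → ℝ) × (Fin N → Fin N → ℝ) := fun ω k =>
    (fun i p c => H k i ω p c, fun i j => A k ω i j)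
  have hvall : Measurable fun ω => fun k => v k ω := measurable_pi_lambda _ hv
  have hHAall : Measurable HA := measurable_pi_lambda _ fun s => (hH s).prodMk (hA s)
  let m' : MeasurableSpace Ω := ⨆ s, ⨆ _ : s < k, MeasurableSpace.comap (v s) inferInstance
  let m₁ : MeasurableSpace Ω := MeasurableSpace.comap (fun ω => fun k => v k ω) inferInstance
  let m₂ : MeasurableSpace Ω := MeasurableSpace.comap HA inferInstance
  have hHAk : ∀ s, Measurable[m₂] fun ω => HA ω s := fun s =>
    measurable_apply_of_pi (comap_measurable HA) s
  have hm' : m' ≤ m₁ := iSup₂_le fun s _ =>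
    measurable_iff_comap_le.1
      (measurable_apply_of_pi (comap_measurable fun ω => fun k => v k ω) s)
  have hm₁ : m₁ ≤ m0 := hvall.comap_le
  have hm₂ : m₂ ≤ m0 := hHAall.comap_le
  have hm'sig : m' ≤ sigBefore H v A k := iSup₂_le fun s hs =>
    (le_sup_right.trans le_sup_left).trans (le_iSup₂_of_le s hs le_rfl)
  have hsig : sigBefore H v A k ≤ m' ⊔ m₂ := iSup₂_le fun s hs => by
    refine sup_le (sup_le ?_ ?_) ?_
    · exact (measurable_iff_comap_le.1 (measurable_fst.comp (hHAk s))).trans le_sup_right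
    · exact (le_iSup₂_of_le (f := fun s (_ : s < k) => MeasurableSpace.comap (v s) inferInstance)
        s hs le_rfl).trans le_sup_left
    · exact (measurable_iff_comap_le.1 (measurable_snd.comp (hHAk s))).trans le_sup_right
  have hsup : m' ⊔ m₂ ≤ m0 := sup_le (hm'.trans hm₁) hm₂
  have hv' : μ[fun ω => v k ω i p|m'] =ᵐ[μ] 0 := by
    have h1 := condExp_condExp_of_le (f := fun ω => v k ω i p) (μ := μ) hm'sig (sigBefore_le hH hv hA k)
    refine h1.symm.trans ((condExp_congr_ae h0).trans ?_)
    simp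
  have hvm : Measurable[m₁] fun ω => v k ω i p :=
    measurable_apply_of_pi (measurable_apply_of_pi
      (measurable_apply_of_pi (comap_measurable fun ω => fun k => v k ω) k) i) p
  have hv'' : μ[fun ω => v k ω i p|m' ⊔ m₂] =ᵐ[μ] 0 :=
    condExp_sup_eq_zero_of_indep hm' hm₁ hm₂ hindep hvm.stronglyMeasurable hInt hv'
  have hHm : Measurable[m₂] fun ω => H k i ω p c :=
    measurable_apply_of_pi (measurable_apply_of_pi
      (measurable_apply_of_pi (measurable_fst.comp (hHAk k)) i) p) c
  have hHs : StronglyMeasurable[m' ⊔ m₂] fun ω => H k i ω p c :=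
    (hHm.mono (le_sup_right : m₂ ≤ m' ⊔ m₂) le_rfl).stronglyMeasurable
  have h2 := condExp_stronglyMeasurable_mul_of_bound hsup hHs hInt B (ae_of_all _ hB)
  have h3 : μ[fun ω => H k i ω p c * v k ω i p|m' ⊔ m₂] =ᵐ[μ] 0 := by
    filter_upwards [h2, hv''] with ω e1 e2
    refine e1.trans ?_
    simp [e2]
  refine (condExp_condExp_of_le hsig hsup).symm.trans ((condExp_congr_ae h3).trans ?_)
  simp

end

/-- **Corollary 1 (Markovian switching graphs and observation matrices).**
Under Assumptions (A1.a), (A1.b), (A3.a), (A3.b) and (A4), with uniformly norm-bounded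
states, if (c.1) the stationary weighted adjacency matrix is nonnegative and balanced and
its digraph contains a spanning tree, and (c.2) the measurement model is
spatially-temporally jointly observable, then the delay-free distributed estimation
algorithm converges in mean square and almost surely. -/
theorem markovian_switching_convergence
    {Ω : Type*} [MeasurableSpace Ω] (μ : Measure Ω) [IsProbabilityMeasure μ]
    (N n : ℕ) (hN : 1 ≤ N) (hn : 1 ≤ n)
    (ni : Fin N → ℕ) (hni : ∀ i, 1 ≤ ni i ∧ ni i ≤ n)
    -- the random observation matrices, noises and weighted adjacency matrices
    (H : ℕ → ∀ i : Fin N, Ω → Matrix (Fin (ni i)) (Fin n) ℝ)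
    (v : ℕ → Ω → ∀ i : Fin N, Fin (ni i) → ℝ)
    (A : ℕ → Ω → Matrix (Fin N) (Fin N) ℝ)
    (hHmeas : ∀ k, Measurable (fun ω (i : Fin N) (p : Fin (ni i)) (c : Fin n) => H k i ω p c))
    (hvmeas : ∀ k, Measurable (v k))
    (hAmeas : ∀ k, Measurable (fun ω (i j : Fin N) => A k ω i j))
    (hAdiag : ∀ k ω i, A k ω i i = 0)
    (hvL2 : ∀ k, Integrable (fun ω => ∑ i, ∑ p, (v k ω i p)^2) μ)
    -- the unknown parameter and the gain sequences
    (x0 : Fin n → ℝ) (a b : ℕ → ℝ)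
    -- the estimates generated by the delay-free algorithm
    (x : ℕ → Fin N → Ω → Fin n → ℝ)
    (hxinit : ∀ i, ∃ c : Fin n → ℝ, ∀ ω, x 0 i ω = c)
    (hrec : ∀ (k : ℕ) (i : Fin N) (ω : Ω), x (k+1) i ω = fun p =>
      x k i ω p
        + a k * ((H k i ω)ᵀ.mulVec
            (((H k i ω).mulVec x0 + v k ω i) - (H k i ω).mulVec (x k i ω))) p
        + b k * ∑ j, A k ω i j * (x k j ω p - x k i ω p))
    -- (A1.a): the noise process is independent of the observation matrices and graphs
    (hA1a : ProbabilityTheory.IndepFun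
      (fun ω => fun k => v k ω)
      (fun ω => fun k =>
        ((fun (i : Fin N) (p : Fin (ni i)) (c : Fin n) => H k i ω p c),
         (fun (i j : Fin N) => A k ω i j))) μ)
    -- (A1.b): martingale difference noise with a.s. bounded conditional second moments
    (βv : ℝ) (hβv : 0 < βv)
    (hA1b1 : ∀ k i p, (μ[(fun ω => v k ω i p)|sigBefore H v A k]) =ᵐ[μ] 0)
    (hA1b2 : ∀ k, ∀ᵐ ω ∂μ,
      (μ[(fun ω' => ∑ i, ∑ p, (v k ω' i p)^2)|sigBefore H v A k]) ω ≤ βv)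
    -- (A3.a)
    (hapos : ∀ k, 0 < a k) (hbpos : ∀ k, 0 < b k)
    (haanti : Antitone a) (hbanti : Antitone b)
    (halim : Tendsto a atTop (𝓝 0)) (hblim : Tendsto b atTop (𝓝 0))
    (haOb : a =O[atTop] b)
    (haOshift : ∀ m : ℕ, 1 ≤ m → a =O[atTop] fun k => a (k + m))
    (hbo : (fun k => (b k)^2) =o[atTop] a)
    (hadiv : Tendsto (fun K => ∑ k ∈ Finset.range K, a k) atTop atTop)
    -- (A3.b)
    (hA3b : Summable (fun k => (b k)^2))
    -- (A4): the joint process ⟨ℋ(k), 𝒜(k)⟩ is a homogeneous uniformly ergodic Markov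
    -- chain on a countable state space `S = {⟨ℋ_l, 𝒜_l⟩ : l ∈ ℕ}` with unique stationary
    -- distribution π.  The chain is encoded by its index process `ℓ`.
    (SH : ℕ → ∀ i : Fin N, Matrix (Fin (ni i)) (Fin n) ℝ)
    (SA : ℕ → Matrix (Fin N) (Fin N) ℝ)
    (ℓ : ℕ → Ω → ℕ) (hℓmeas : ∀ k, Measurable (ℓ k))
    (hstate : ∀ k ω, (∀ i, H k i ω = SH (ℓ k ω) i) ∧ A k ω = SA (ℓ k ω))
    -- the one-step transition function
    (P : ℕ → ℕ → ℝ) (hPnonneg : ∀ s l, 0 ≤ P s l) (hPsum : ∀ s, HasSum (P s) 1)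
    -- homogeneous Markov property with respect to the filtration (ℱ(k))
    (hMarkov : ∀ k l, (μ[(fun ω => if ℓ (k+1) ω = l then (1:ℝ) else 0)|
        sigBefore H v A (k+1)]) =ᵐ[μ] fun ω => P (ℓ k ω) l)
    -- the m-step transition function (Chapman–Kolmogorov)
    (Pm : ℕ → ℕ → ℕ → ℝ) (hPm1 : ∀ s l, Pm 1 s l = P s l)
    (hPmCK : ∀ m s l, Pm (m+1) s l = ∑' l', Pm m s l' * P l' l)
    -- the stationary distribution π, its stationarity and uniqueness
    (pi : ℕ → ℝ) (hπnonneg : ∀ l, 0 ≤ pi l) (hπsum : HasSum pi 1)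
    (hπstat : ∀ l, ∑' s, pi s * P s l = pi l)
    (hπuniq : ∀ pi' : ℕ → ℝ, (∀ l, 0 ≤ pi' l) → HasSum pi' 1 →
      (∀ l, ∑' s, pi' s * P s l = pi' l) → pi' = pi)
    -- uniform ergodicity
    (R r : ℝ) (hR : 0 < R) (hr : 1 < r)
    (herg : ∀ s m, 1 ≤ m → ∑' l, |Pm m s l - pi l| ≤ R / r ^ m)
    -- uniformly norm-bounded states: sup_l ‖𝒜_l‖ < ∞ and sup_l ‖ℋ_l‖ < ∞
    (hAbdd : ∃ C : ℝ, ∀ l, specNorm (SA l) ≤ C)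
    (hHbdd : ∃ C : ℝ, ∀ l, specNorm (blockH (SH l)) ≤ C)
    -- (c.1): the stationary adjacency matrix is nonnegative, balanced, and its digraph
    -- (an edge from j to i whenever entry (i,j) is positive) contains a spanning tree
    (hc1nonneg : ∀ i j, 0 ≤ ∑' l, pi l * SA l i j)
    (hc1bal : ∀ i : Fin N, ∑ j, ∑' l, pi l * SA l i j = ∑ j, ∑' l, pi l * SA l j i)
    (hc1tree : ∃ root : Fin N, ∀ i : Fin N,
      Relation.ReflTransGen (fun u w => 0 < ∑' l, pi l * SA l w u) root i)
    -- (c.2): spatial-temporal joint observability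
    (hc2 : Matrix.PosDef
      (Matrix.of fun p q : Fin n => ∑ i : Fin N, ∑' l, pi l * (((SH l i)ᵀ * SH l i) p q))) :
    -- conclusion: mean square convergence and almost sure convergence at every node
    (∀ i, Tendsto (fun k => ∫ ω, ∑ p, (x k i ω p - x0 p)^2 ∂μ) atTop (𝓝 0)) ∧
    (∀ᵐ ω ∂μ, ∀ i, Tendsto (fun k => x k i ω) atTop (𝓝 x0)) := by
  classical
  obtain ⟨CA, hCA⟩ := hAbdd
  obtain ⟨CH, hCH⟩ := hHbdd
  have hSA : ∀ l i j, |SA l i j| ≤ CA := fun l i j =>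
    (abs_entry_le_specNorm (SA l) i j).trans (hCA l)
  have hSH : ∀ l i p c, |SH l i p c| ≤ CH := fun l i p c =>
    (abs_entry_le_specNorm_blockH (SH l) i p c).trans (hCH l)
  have hHb : ∀ k i ω p c, |H k i ω p c| ≤ CH := fun k i ω p c => by
    rw [(hstate k ω).1 i]
    exact hSH _ i p c
  have hCA0 : 0 ≤ CA := (abs_nonneg _).trans (hSA 0 ⟨0, hN⟩ ⟨0, hN⟩)
  obtain ⟨C₀, -, hC₀⟩ := Asymptotics.bound_of_isBigO_nat_atTop haOb
  obtain ⟨C, hC1, hab⟩ : ∃ C : ℝ, 1 ≤ C ∧ ∀ k, a k ≤ C * b k := by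
    refine ⟨max C₀ 1, le_max_right _ _, fun k => ?_⟩
    have h := hC₀ (hbpos k).ne'
    rw [Real.norm_of_nonneg (hapos k).le, Real.norm_of_nonneg (hbpos k).le] at h
    exact h.trans (mul_le_mul_of_nonneg_right (le_max_left _ _) (hbpos k).le)
  have hC0 : 0 ≤ C := zero_le_one.trans hC1
  let ℱ : Filtration ℕ _ :=
    ⟨sigBefore H v A, sigBefore_mono, sigBefore_le hHmeas hvmeas hAmeas⟩
  let e : ℕ → Ω → Fin N × Fin n → ℝ := fun k ω s => x k s.1 ω s.2 - x0 s.2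
  let w : ℕ → Ω → Fin N × Fin n → ℝ := fun k ω s => a k * ((H k s.1 ω)ᵀ *ᵥ v k ω s.1) s.2
  let K : ℕ → Fin N → Matrix (Fin n) (Fin n) ℝ := fun l i => (SH l i)ᵀ * SH l i
  have hKb : ∀ l i c d, |K l i c d| ≤ n * CH ^ 2 := fun l i c d => by
    refine (abs_transpose_mul_self_le (hSH l i) c d).trans ?_
    rw [Fintype.card_fin]
    exact mul_le_mul_of_nonneg_right (Nat.cast_le.2 (hni i).2) (sq_nonneg _)
  have hKs : ∀ i c d, Summable fun l => pi l * K l i c d := fun i c d =>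
    summable_mul_of_abs_le hπnonneg hπsum.summable fun l => hKb l i c d
  let Kbar : Fin N → Matrix (Fin n) (Fin n) ℝ := fun i =>
    Matrix.of fun c d => ∑' l, pi l * K l i c d
  let Abar : Matrix (Fin N) (Fin N) ℝ := Matrix.of fun i j => ∑' l, pi l * SA l i j
  have hKbar : ∀ i u, 0 ≤ u ⬝ᵥ Kbar i *ᵥ u := fun i u =>
    (hasSum_dotProduct_mulVec (hKs i) u).nonneg fun l =>
      mul_nonneg (hπnonneg l) (dotProduct_transpose_mul_self_nonneg _ _)
  have hKpos : ∀ u : Fin n → ℝ, u ≠ 0 → 0 < ∑ i, u ⬝ᵥ Kbar i *ᵥ u := fun u hu => by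
    have h := hc2.dotProduct_mulVec_pos hu
    rw [star_trivial] at h
    have heq : (Matrix.of fun p q : Fin n =>
        ∑ i : Fin N, ∑' l, pi l * (((SH l i)ᵀ * SH l i) p q)) = ∑ i, Kbar i := by
      ext c d
      simp [Kbar, K, Matrix.sum_apply]
    rwa [heq, Matrix.sum_mulVec, dotProduct_sum] at h
  obtain ⟨c, hc, hcoer⟩ := exists_pos_mul_dotProduct_le_gain (W := Abar) hc1nonneg hc1bal hc1tree
    hKbar hKpos hC1
  have hvsq : ∀ k i p, Integrable (fun ω => (v k ω i p) ^ 2) μ := fun k i p =>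
    (hvL2 k).mono' ((measurable_apply_of_pi (measurable_apply_of_pi (hvmeas k) i)
      p).pow_const 2).aestronglyMeasurable (ae_of_all _ fun ω => by
        rw [Real.norm_of_nonneg (sq_nonneg _)]
        exact (Finset.single_le_sum (f := fun p => (v k ω i p) ^ 2) (fun p _ => sq_nonneg _)
          (Finset.mem_univ p)).trans (Finset.single_le_sum
            (f := fun i => ∑ p, (v k ω i p) ^ 2)
            (fun i _ => Finset.sum_nonneg fun p _ => sq_nonneg _) (Finset.mem_univ i)))
  have hvL : ∀ k i p, MemLp (fun ω => v k ω i p) 2 μ := fun k i p =>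
    (memLp_two_iff_integrable_sq (measurable_apply_of_pi (measurable_apply_of_pi (hvmeas k) i)
      p).aestronglyMeasurable).2 (hvsq k i p)
  have hHm : ∀ k i p c, Measurable fun ω => H k i ω p c := fun k i p c =>
    measurable_apply_of_pi (measurable_apply_of_pi (measurable_apply_of_pi (hHmeas k) i) p) c
  have hHvL : ∀ k i p c, MemLp (fun ω => H k i ω p c * v k ω i p) 2 μ := fun k i p c =>
    MemLp.of_le_mul (c := CH) (hvL k i p)
      ((hHm k i p c).aestronglyMeasurable.mul (hvL k i p).1) (ae_of_all _ fun ω => by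
        rw [norm_mul]
        exact mul_le_mul_of_nonneg_right (hHb k i ω p c) (norm_nonneg _))
  have hw_eq : ∀ k s, (fun ω => w k ω s)
      = a k • ∑ p, fun ω => H k s.1 ω p s.2 * v k ω s.1 p := fun k s => by
    ext ω
    simp [w, mulVec, dotProduct]
  have hwL2 : ∀ k s, MemLp (fun ω => w k ω s) 2 μ := fun k s => by
    rw [hw_eq]
    exact (memLp_finsetSum' _ fun p _ => hHvL k s.1 p s.2).const_smul (a k)
  have hwc : ∀ k s, μ[fun ω => w k ω s|ℱ k] =ᵐ[μ] 0 := fun k s => by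
    rw [hw_eq]
    refine (condExp_smul _ _ _).trans ?_
    have h1 := condExp_finsetSum (μ := μ) (s := Finset.univ)
      (fun p _ => (hHvL k s.1 p s.2).integrable one_le_two) (ℱ k)
    have h2 : ∀ᵐ ω ∂μ, ∀ p, (μ[fun ω => H k s.1 ω p s.2 * v k ω s.1 p|ℱ k]) ω = 0 :=
      ae_all_iff.2 fun p => condExp_obs_mul_noise_eq_zero hHmeas hvmeas hAmeas hA1a
        (fun ω => hHb k s.1 ω p s.2) ((hvL k s.1 p).integrable one_le_two) (hA1b1 k s.1 p)
    filter_upwards [h1, h2] with ω e1 e2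
    rw [Pi.smul_apply, e1, Finset.sum_apply, Finset.sum_eq_zero fun p _ => e2 p]
    simp
  have hww : ∀ k ω, w k ω ⬝ᵥ w k ω ≤ (a k ^ 2 * (n * (n * CH ^ 2))) * ∑ i, ∑ p, (v k ω i p) ^ 2 := by
    intro k ω
    calc w k ω ⬝ᵥ w k ω
        = ∑ i, ∑ c, a k ^ 2 * (((H k i ω)ᵀ *ᵥ v k ω i) c) ^ 2 := by
          simp only [dotProduct, Fintype.sum_prod_type, w]
          exact Finset.sum_congr rfl fun i _ => Finset.sum_congr rfl fun c _ => by ring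
      _ ≤ ∑ i, ∑ _c : Fin n, a k ^ 2 * (n * CH ^ 2 * ∑ p, (v k ω i p) ^ 2) := by
          refine Finset.sum_le_sum fun i _ => Finset.sum_le_sum fun c _ =>
            mul_le_mul_of_nonneg_left ?_ (sq_nonneg _)
          refine (transpose_mulVec_sq_le (hHb k i ω) (v k ω i) c).trans ?_
          rw [Fintype.card_fin]
          exact mul_le_mul_of_nonneg_right
            (mul_le_mul_of_nonneg_right (Nat.cast_le.2 (hni i).2) (sq_nonneg _))
            (Finset.sum_nonneg fun p _ => sq_nonneg _)
      _ = _ := by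
          rw [Finset.mul_sum]
          refine Finset.sum_congr rfl fun i _ => ?_
          rw [Finset.sum_const, Finset.card_univ, Fintype.card_fin, nsmul_eq_mul]
          ring
  have hw2 : ∀ k, μ[fun ω => w k ω ⬝ᵥ w k ω|ℱ k]
      ≤ᵐ[μ] fun _ => a k ^ 2 * (n * (n * CH ^ 2)) * βv := fun k => by
    have hInt : Integrable (fun ω => w k ω ⬝ᵥ w k ω) μ :=
      integrable_finsetSum _ fun s _ => (hwL2 k s).integrable_mul (hwL2 k s)
    have h1 := condExp_mono (m := ℱ k) hInt ((hvL2 k).smul (a k ^ 2 * (n * (n * CH ^ 2))))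
      (ae_of_all _ (hww k))
    have h2 := condExp_smul (μ := μ) (a k ^ 2 * (n * (n * CH ^ 2)))
      (fun ω => ∑ i, ∑ p, (v k ω i p) ^ 2) (ℱ k)
    filter_upwards [h1, h2, hA1b2 k] with ω e1 e2 e3
    refine e1.trans (e2.le.trans ?_)
    exact mul_le_mul_of_nonneg_left e3 (by positivity)
  have hηs : Summable fun k => a k ^ 2 * (n * (n * CH ^ 2)) * βv := by
    refine Summable.mul_right _ (Summable.mul_right _ ?_)
    refine Summable.of_nonneg_of_le (fun k => sq_nonneg _) (fun k => ?_) (hA3b.mul_left (C ^ 2))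
    rw [← mul_pow]
    exact pow_le_pow_left₀ (hapos k).le (hab k) 2
  have herec : ∀ k ω, e (k + 1) ω = e k ω - (a k • nodeBlock (K (ℓ k ω))
      + b k • nodeLaplacian (SA (ℓ k ω))) *ᵥ e k ω + w k ω := fun k ω => by
    ext ⟨i, c⟩
    have hK' : K (ℓ k ω) i = (H k i ω)ᵀ * H k i ω := by
      simp only [K, (hstate k ω).1 i]
    have he' : (fun c' => e k ω (i, c')) = x k i ω - x0 := rfl
    simp only [Pi.add_apply, Pi.sub_apply, add_mulVec, smul_mulVec, Pi.smul_apply, smul_eq_mul,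
      nodeBlock_mulVec, nodeLaplacian_mulVec, hK', he', ← (hstate k ω).2]
    simp only [e, w, hrec k i ω, mulVec_sub, mulVec_add, Pi.add_apply, Pi.sub_apply,
      ← mulVec_mulVec]
    have hsum : ∑ j, A k ω i j * (x k i ω c - x0 c - (x k j ω c - x0 c))
        = -∑ j, A k ω i j * (x k j ω c - x k i ω c) := by
      rw [← Finset.sum_neg_distrib]
      exact Finset.sum_congr rfl fun j _ => by ring
    rw [hsum]
    ring
  have hxadp : ∀ k i c, Measurable[ℱ k] fun ω => x k i ω c := by
    intro k
    induction k with
    | zero =>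
      intro i c
      obtain ⟨y, hy⟩ := hxinit i
      simp only [hy]
      exact measurable_const
    | succ k ih =>
      intro i c
      have ih' : ∀ i c, Measurable[ℱ (k + 1)] fun ω => x k i ω c := fun i c =>
        (ih i c).mono (ℱ.mono k.le_succ) le_rfl
      simp only [hrec k i]
      exact measurable_estimate_step x0 (a k) (b k)
        (fun p c => measurable_obs_sigBefore k.lt_succ_self i p c)
        (fun p => measurable_noise_sigBefore k.lt_succ_self i p)
        (fun j => measurable_weight_sigBefore k.lt_succ_self i j) ih' c
  obtain ⟨hInt, hms, has⟩ := tendsto_zero_of_markov_modulated_recursion (μ := μ) ℱ (e := e) (w := w)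
    (D := fun l => nodeBlock (K l)) (L := fun l => nodeLaplacian (SA l))
    (α := fun k => c * a k) (η := fun k => a k ^ 2 * (n * (n * CH ^ 2)) * βv)
    (B := max (n * CH ^ 2) ((Fintype.card (Fin N) + 1) * CA)) (C := C)
    (fun k => (hapos k).le) (fun k => (hbpos k).le) haanti hbanti hblim hA3b hC0 hab
    (fun l s t => (abs_nodeBlock_le (by positivity) (hKb l) s t).trans (le_max_left _ _))
    (fun l s t => (abs_nodeLaplacian_le hCA0 (hSA l) s t).trans (le_max_right _ _))
    hℓmeas hPnonneg hPsum hMarkov hPm1 hPmCK hπnonneg hπsum hr herg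
    (fun k => mul_nonneg hc.le (hapos k).le)
    (by simpa only [← Finset.mul_sum] using hadiv.const_mul_atTop hc)
    (fun k => by positivity) hηs
    (fun k u => by
      rw [tsum_nodeBlock, tsum_nodeLaplacian hπnonneg hπsum.summable hSA]
      exact hcoer (a k) (b k) (hapos k).le (hab k) u)
    herec (fun k s => ((hxadp k s.1 s.2).sub_const _).stronglyMeasurable)
    (fun s => by
      obtain ⟨y, hy⟩ := hxinit s.1
      simp only [e, hy]
      exact memLp_const _)
    hwL2 hwc hw2
  have hnode : ∀ k ω i, ∑ p, (x k i ω p - x0 p) ^ 2 ≤ e k ω ⬝ᵥ e k ω := fun k ω i => by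
    simp only [dotProduct, Fintype.sum_prod_type, ← sq]
    exact Finset.single_le_sum (f := fun i => ∑ p, (x k i ω p - x0 p) ^ 2)
      (fun i _ => Finset.sum_nonneg fun p _ => sq_nonneg _) (Finset.mem_univ i)
  refine ⟨fun i => squeeze_zero (fun k => integral_nonneg fun ω =>
    Finset.sum_nonneg fun p _ => sq_nonneg _) (fun k => ?_) hms, ?_⟩
  · exact integral_mono_of_nonneg (ae_of_all _ fun ω => Finset.sum_nonneg fun p _ => sq_nonneg _)
      (hInt k) (ae_of_all _ fun ω => hnode k ω i)
  · filter_upwards [has] with ω hω i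
    refine tendsto_pi_nhds.2 fun p => tendsto_sub_nhds_zero_iff.1 ?_
    have hsq : Tendsto (fun k => (x k i ω p - x0 p) ^ 2) atTop (𝓝 0) :=
      squeeze_zero (fun k => sq_nonneg _) (fun k => (Finset.single_le_sum
        (f := fun p => (x k i ω p - x0 p) ^ 2) (fun p _ => sq_nonneg _)
        (Finset.mem_univ p)).trans (hnode k ω i)) hω
    refine (tendsto_zero_iff_abs_tendsto_zero _).2 ?_
    simpa [Function.comp_def, Real.sqrt_sq_eq_abs] using hsq.sqrt
end

section
/- Suppose Assumptions (A2.b) and (A3.c) hold. Then there exists a constant κ ∈ (0,1) such that, for every k ≥ 0, the matrix F(k) is invertible almost surely and ‖F(k)⁻¹‖ ≤ (1 − κ)⁻¹ almost surely (so in particular the recursion defining F(k) is well-posed for all k). -/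
open MeasureTheory Filter Matrix Topology
open scoped Kronecker

/-- Degree matrix of a weighted adjacency matrix. -/
def degMat {N : ℕ} (A : Matrix (Fin N) (Fin N) ℝ) : Matrix (Fin N) (Fin N) ℝ :=
  Matrix.diagonal (fun i => ∑ j, A i j)

/-- The `Nn × Nn` matrix `ℋᵀℋ`, where `ℋ = blockdiag(H_1, …, H_N)`. -/
def blockHtH {N n : ℕ} {ni : Fin N → ℕ}
    (H : ∀ i : Fin N, Matrix (Fin (ni i)) (Fin n) ℝ) :
    Matrix (Fin N × Fin n) (Fin N × Fin n) ℝ :=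
  Matrix.of fun p q => if p.1 = q.1 then ((H p.1)ᵀ * H p.1) p.2 q.2 else 0

/-- Delay matrix `𝕀(k,q)`: entry `(i,j)` is `1` if `λ_{ji}(k) = q` and `0` otherwise. -/
def delayMat {N : ℕ} (lam : Fin N → Fin N → ℕ) (q : ℕ) : Matrix (Fin N) (Fin N) ℝ :=
  Matrix.of fun i j => if lam j i = q then 1 else 0

/-- The delay-weighted adjacency matrix `Ā(k,q) = (𝒜(k) ∘ 𝕀(k,q)) ⊗ I_n`. -/
def delayAdj {N : ℕ} (n : ℕ) (A : Matrix (Fin N) (Fin N) ℝ)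
    (lam : Fin N → Fin N → ℕ) (q : ℕ) :
    Matrix (Fin N × Fin n) (Fin N × Fin n) ℝ :=
  (Matrix.hadamard A (delayMat lam q)) ⊗ₖ (1 : Matrix (Fin n) (Fin n) ℝ)

/-- The backward matrix product `Φ_F(j,i) = F(j)F(j−1)⋯F(i)` for `j ≥ i`, and `I` for
`j < i`, for a family of square matrices indexed by `ℤ`. -/
noncomputable def phiProdZ {p : Type*} [Fintype p] [DecidableEq p]
    (F : ℤ → Matrix p p ℝ) (j i : ℤ) : Matrix p p ℝ :=
  if i ≤ j then ((List.range ((j - i).toNat + 1)).map (fun t => F (j - (t:ℤ)))).prod else 1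

section L2Operator

open scoped Matrix.Norms.L2Operator

lemma Matrix.l2_opNorm_le_of_sum_sq_le {p q : Type*} [Fintype p] [Fintype q] [DecidableEq q]
    {M : Matrix p q ℝ} {C : ℝ} (hC : 0 ≤ C)
    (h : ∀ v : q → ℝ, ∑ i, (M *ᵥ v) i ^ 2 ≤ C ^ 2 * ∑ j, v j ^ 2) : ‖M‖ ≤ C := by
  refine ContinuousLinearMap.opNorm_le_bound _ hC fun v => ?_
  refine le_of_sq_le_sq ?_ (by positivity)
  rw [mul_pow, EuclideanSpace.real_norm_sq_eq, EuclideanSpace.real_norm_sq_eq]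
  exact h v.ofLp

lemma Matrix.sum_sq_mulVec_le {p q : Type*} [Fintype p] [Fintype q] [DecidableEq q]
    {M : Matrix p q ℝ} {C : ℝ} (h : ‖M‖ ≤ C) (v : q → ℝ) :
    ∑ i, (M *ᵥ v) i ^ 2 ≤ C ^ 2 * ∑ j, v j ^ 2 := by
  have h1 := M.l2_opNorm_mulVec (WithLp.toLp 2 v)
  have h2 := pow_le_pow_left₀ (norm_nonneg _)
    (h1.trans (mul_le_mul_of_nonneg_right h (norm_nonneg _))) 2
  rw [mul_pow, EuclideanSpace.real_norm_sq_eq, EuclideanSpace.real_norm_sq_eq] at h2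
  exact h2

lemma Matrix.l2_opNorm_kronecker_one_le {N n : ℕ} {M : Matrix (Fin N) (Fin N) ℝ} {β : ℝ}
    (hβ : 0 ≤ β) (h : ∀ i j, |M i j| ≤ β) :
    ‖M ⊗ₖ (1 : Matrix (Fin n) (Fin n) ℝ)‖ ≤ N * β := by
  refine Matrix.l2_opNorm_le_of_sum_sq_le (by positivity) fun v => ?_
  have key : ∀ i s, ((M ⊗ₖ (1 : Matrix (Fin n) (Fin n) ℝ)) *ᵥ v) (i, s) ^ 2
      ≤ N * β ^ 2 * ∑ j, v (j, s) ^ 2 := fun i s => by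
    have e : ((M ⊗ₖ (1 : Matrix (Fin n) (Fin n) ℝ)) *ᵥ v) (i, s) = ∑ j, M i j * v (j, s) := by
      simp [Matrix.mulVec, dotProduct, Fintype.sum_prod_type, Matrix.one_apply]
    rw [e]
    refine (Finset.sum_mul_sq_le_sq_mul_sq _ _ _).trans
      (mul_le_mul_of_nonneg_right ?_ (Finset.sum_nonneg fun _ _ => sq_nonneg _))
    calc ∑ j, M i j ^ 2 ≤ ∑ _j : Fin N, β ^ 2 :=
          Finset.sum_le_sum fun j _ => sq_le_sq' (abs_le.1 (h i j)).1 (abs_le.1 (h i j)).2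
      _ = N * β ^ 2 := by simp
  rw [Fintype.sum_prod_type]
  calc ∑ i, ∑ s, ((M ⊗ₖ (1 : Matrix (Fin n) (Fin n) ℝ)) *ᵥ v) (i, s) ^ 2
      ≤ ∑ _i : Fin N, ∑ s, N * β ^ 2 * ∑ j, v (j, s) ^ 2 :=
        Finset.sum_le_sum fun i _ => Finset.sum_le_sum fun s _ => key i s
    _ = (N * β) ^ 2 * ∑ p, v p ^ 2 := by
        rw [Fintype.sum_prod_type_right, Finset.sum_const, ← Finset.mul_sum]
        simp only [Finset.card_univ, Fintype.card_fin, nsmul_eq_mul]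
        ring

lemma l2_opNorm_degMat_kronecker_one_le {N n : ℕ} {A : Matrix (Fin N) (Fin N) ℝ} {β : ℝ}
    (hβ : 0 ≤ β) (h : ∀ i j, |A i j| ≤ β) :
    ‖degMat A ⊗ₖ (1 : Matrix (Fin n) (Fin n) ℝ)‖ ≤ N * β := by
  rw [degMat, ← Matrix.diagonal_one, Matrix.diagonal_kronecker_diagonal, Matrix.l2_opNorm_diagonal,
    pi_norm_le_iff_of_nonneg (by positivity)]
  intro p
  rw [mul_one, Real.norm_eq_abs]
  calc |∑ j, A p.1 j| ≤ ∑ j, |A p.1 j| := Finset.abs_sum_le_sum_abs _ _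
    _ ≤ ∑ _j : Fin N, β := Finset.sum_le_sum fun j _ => h _ _
    _ = N * β := by simp

lemma l2_opNorm_delayAdj_le {N n : ℕ} {A : Matrix (Fin N) (Fin N) ℝ} {β : ℝ}
    (hβ : 0 ≤ β) (h : ∀ i j, |A i j| ≤ β) (lam : Fin N → Fin N → ℕ) (q : ℕ) :
    ‖delayAdj n A lam q‖ ≤ N * β := by
  refine Matrix.l2_opNorm_kronecker_one_le hβ fun i j => ?_
  by_cases hq : lam j i = q
  · simpa [delayMat, hq] using h i j
  · simpa [delayMat, hq] using hβ

lemma l2_opNorm_blockHtH_le {N n : ℕ} {ni : Fin N → ℕ}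
    {H : ∀ i : Fin N, Matrix (Fin (ni i)) (Fin n) ℝ} {β : ℝ} (h : ∀ i, ‖H i‖ ≤ β) :
    ‖blockHtH H‖ ≤ β ^ 2 := by
  refine Matrix.l2_opNorm_le_of_sum_sq_le (by positivity) fun v => ?_
  have e : ∀ i s, (blockHtH H *ᵥ v) (i, s)
      = (((H i)ᵀ * H i) *ᵥ fun t => v (i, t)) s := fun i s => by
    simp only [blockHtH, Matrix.mulVec, dotProduct, Fintype.sum_prod_type, Matrix.of_apply,
      ite_mul, zero_mul]
    rw [Finset.sum_eq_single i (fun j _ hj => by simp [Ne.symm hj]) (by simp)]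
    simp
  simp only [Fintype.sum_prod_type, e]
  rw [Finset.mul_sum]
  refine Finset.sum_le_sum fun i _ => Matrix.sum_sq_mulVec_le (M := (H i)ᵀ * H i) ?_ _
  have hT : (H i)ᵀ = (H i)ᴴ := (Matrix.conjTranspose_eq_transpose_of_trivial _).symm
  rw [hT, Matrix.l2_opNorm_conjTranspose_mul_self, ← sq]
  exact pow_le_pow_left₀ (norm_nonneg _) (h i) 2

lemma Matrix.l2_opNorm_one_le {p : Type*} [Fintype p] [DecidableEq p] :
    ‖(1 : Matrix p p ℝ)‖ ≤ 1 :=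
  Matrix.l2_opNorm_le_of_sum_sq_le zero_le_one fun v => by simp

lemma Matrix.isUnit_and_l2_opNorm_inv_le {p : Type*} [Fintype p] [DecidableEq p]
    {M : Matrix p p ℝ} {κ : ℝ} (hκ : κ < 1) (h : ‖1 - M‖ ≤ κ) :
    IsUnit M ∧ ‖M⁻¹‖ ≤ (1 - κ)⁻¹ := by
  have hu : IsUnit M := by
    simpa using isUnit_one_sub_of_norm_lt_one (h.trans_lt hκ)
  refine ⟨hu, ?_⟩
  have e : M⁻¹ = 1 + (1 - M) * M⁻¹ := by
    rw [sub_mul, one_mul, Matrix.mul_nonsing_inv _ ((Matrix.isUnit_iff_isUnit_det _).1 hu)]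
    abel
  have h1 : ‖M⁻¹‖ ≤ 1 + κ * ‖M⁻¹‖ := by
    conv_lhs => rw [e]
    refine (norm_add_le _ _).trans (add_le_add Matrix.l2_opNorm_one_le ?_)
    exact (norm_mul_le _ _).trans (mul_le_mul_of_nonneg_right h (norm_nonneg _))
  rw [← one_div (1 - κ), le_div_iff₀ (by linarith)]
  linarith

lemma Matrix.l2_opNorm_inv_prod_le {p : Type*} [Fintype p] [DecidableEq p] {x : ℝ}
    (l : List (Matrix p p ℝ)) (h : ∀ M ∈ l, ‖M⁻¹‖ ≤ x) : ‖l.prod⁻¹‖ ≤ x ^ l.length := by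
  induction l with
  | nil => simpa using Matrix.l2_opNorm_one_le
  | cons M l ih =>
    rw [List.prod_cons, Matrix.mul_inv_rev, List.length_cons, pow_succ]
    have hM := h M (by simp)
    have hl := ih fun M' hM' => h M' (by simp [hM'])
    exact (norm_mul_le _ _).trans
      (mul_le_mul hl hM (norm_nonneg _) (pow_nonneg ((norm_nonneg _).trans hM) _))

lemma l2_opNorm_inv_phiProdZ_le {p : Type*} [Fintype p] [DecidableEq p] {x : ℝ}
    {F : ℤ → Matrix p p ℝ} {k : ℤ} {q : ℕ}
    (h : ∀ t : ℤ, k - q ≤ t → t < k → ‖(F t)⁻¹‖ ≤ x) :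
    ‖(phiProdZ F (k - 1) (k - q))⁻¹‖ ≤ x ^ q := by
  unfold phiProdZ
  split_ifs with hq
  · have hlen : (k - 1 - (k - q)).toNat + 1 = q := by omega
    rw [hlen]
    refine (Matrix.l2_opNorm_inv_prod_le (x := x) _ fun M hM => ?_).trans_eq (by simp)
    obtain ⟨t, ht, rfl⟩ := List.mem_map.1 hM
    obtain ⟨s, hs, rfl⟩ : ∃ s < q, t = (s : ℤ) := by simpa using ht
    exact h _ (by omega) (by omega)
  · obtain rfl : q = 0 := by omega
    simpa using Matrix.l2_opNorm_one_le

lemma norm_sub_delay_sum_le {N n d : ℕ} {ni : Fin N → ℕ}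
    {H : ∀ i : Fin N, Matrix (Fin (ni i)) (Fin n) ℝ} {A : Matrix (Fin N) (Fin N) ℝ}
    {lam : Fin N → Fin N → ℕ} {P : ℕ → Matrix (Fin N × Fin n) (Fin N × Fin n) ℝ}
    {a b βa βH x : ℝ} (ha : 0 ≤ a) (hb : 0 ≤ b) (hβa : 0 ≤ βa)
    (hA : ∀ i j, |A i j| ≤ βa) (hH : ∀ i, ‖H i‖ ≤ βH)
    (hP : ∀ q ∈ Finset.range (d + 1), ‖P q‖ ≤ x ^ q) :
    ‖b • (degMat A ⊗ₖ (1 : Matrix (Fin n) (Fin n) ℝ)) + a • blockHtH H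
        - b • ∑ q ∈ Finset.range (d + 1), delayAdj n A lam q * P q‖
      ≤ b * (N * βa) + a * βH ^ 2 + b * (N * βa * ∑ q ∈ Finset.range (d + 1), x ^ q) := by
  refine (norm_sub_le _ _).trans (add_le_add ((norm_add_le _ _).trans (add_le_add ?_ ?_)) ?_)
  · rw [norm_smul, Real.norm_of_nonneg hb]
    exact mul_le_mul_of_nonneg_left (l2_opNorm_degMat_kronecker_one_le hβa hA) hb
  · rw [norm_smul, Real.norm_of_nonneg ha]
    exact mul_le_mul_of_nonneg_left (l2_opNorm_blockHtH_le hH) ha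
  · rw [norm_smul, Real.norm_of_nonneg hb, Finset.mul_sum]
    refine mul_le_mul_of_nonneg_left (norm_sum_le_of_le _ fun q hq => ?_) hb
    exact (norm_mul_le _ _).trans
      (mul_le_mul (l2_opNorm_delayAdj_le hβa hA lam q) (hP q hq) (norm_nonneg _) (by positivity))

end L2Operator

lemma gain_bound {N d : ℕ} (hN : 1 ≤ N) {a b B βa βH Ca κ : ℝ} (ha : 0 < a) (hb : 0 < b)
    (hβa : 0 < βa) (hβH : 0 < βH) (hκ0 : 0 < κ) (hκ1 : κ < 1) (hCa : a ≤ Ca * b) (hbB : b ≤ B)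
    (hB : B < min (κ / (2 * (N * βa + N * Real.sqrt N * βa + Ca * βH ^ 2)))
        ((1 - (1 - κ)⁻¹) * κ / (2 * N * Real.sqrt N * βa * (1 - (1 - κ) ^ (-(d + 1 : ℤ)))))) :
    b * (N * βa) + a * βH ^ 2 + b * (N * βa * ∑ q ∈ Finset.range (d + 1), (1 - κ)⁻¹ ^ q)
      ≤ κ := by
  obtain ⟨h1, h2⟩ := lt_min_iff.1 (hbB.trans_lt hB)
  have hN0 : (1 : ℝ) ≤ N := by exact_mod_cast hN
  have hsqrt : 1 ≤ Real.sqrt N := Real.one_le_sqrt.2 hN0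
  have hCa0 : 0 < Ca := pos_of_mul_pos_left (ha.trans_le hCa) hb.le
  set x := (1 - κ)⁻¹ with hx
  have hx1 : 1 < x := (one_lt_inv₀ (by linarith)).2 (by linarith)
  set S := ∑ q ∈ Finset.range (d + 1), x ^ q with hS
  have hSpos : 0 < S := Finset.sum_pos (fun q _ => by positivity) (by simp)
  have hpow : (1 - κ) ^ (-(d + 1 : ℤ)) = x ^ (d + 1) := by
    rw [_root_.zpow_neg, hx, _root_.inv_pow]; norm_cast
  have hgeom : 1 - x ^ (d + 1) = (1 - x) * S := by
    have := geom_sum_mul x (d + 1)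
    rw [← hS] at this
    linarith
  have h2' : b < κ / (2 * N * Real.sqrt N * βa * S) := by
    refine h2.trans_eq ?_
    rw [hpow, hgeom]
    have : 1 - x ≠ 0 := by linarith
    field_simp
  rw [lt_div_iff₀ (by positivity)] at h1 h2'
  have e1 : a * βH ^ 2 ≤ Ca * b * βH ^ 2 := mul_le_mul_of_nonneg_right hCa (by positivity)
  have e2 : 0 ≤ b * (N * Real.sqrt N * βa) := by positivity
  have e3 : b * (N * βa * S) * 1 ≤ b * (N * βa * S) * Real.sqrt N :=
    mul_le_mul_of_nonneg_left hsqrt (by positivity)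
  linarith

/-- **Lemma 8 (invertibility of `F(k)`).**
Under Assumptions (A2.b) and (A3.c) there is a constant `κ ∈ (0,1)` such that every
`F(k)` (defined by the delay-elimination recursion) is invertible a.s. with
`‖F(k)⁻¹‖ ≤ (1−κ)⁻¹` a.s. -/
theorem F_invertible
    {Ω : Type*} [MeasurableSpace Ω] (μ : Measure Ω) [IsProbabilityMeasure μ]
    (N n : ℕ) (hN : 1 ≤ N) (hn : 1 ≤ n) (d : ℕ) (hd : 1 ≤ d)
    (ni : Fin N → ℕ) (hni : ∀ i, 1 ≤ ni i ∧ ni i ≤ n)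
    -- the random observation matrices, adjacency matrices and delays
    (H : ℕ → ∀ i : Fin N, Ω → Matrix (Fin (ni i)) (Fin n) ℝ)
    (A : ℕ → Ω → Matrix (Fin N) (Fin N) ℝ)
    (lam : ℕ → Fin N → Fin N → Ω → ℕ)
    (hAdiag : ∀ k ω i, A k ω i i = 0)
    (hlamrange : ∀ k j i ω, lam k j i ω ≤ d)
    (hlamdiag : ∀ k i, ∀ᵐ ω ∂μ, lam k i i ω = 0)
    -- the gain sequences
    (a b : ℕ → ℝ) (hapos : ∀ k, 0 < a k) (hbpos : ∀ k, 0 < b k)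
    -- (A2.b)
    (βa βH : ℝ) (hβa : 0 < βa) (hβH : 0 < βH)
    (hA2b : ∀ᵐ ω ∂μ, (∀ k i j, |A k ω i j| ≤ βa) ∧ (∀ k i, specNorm (H k i ω) ≤ βH))
    -- (A3.c)
    (Ca : ℝ) (hCa : ∀ k, a k ≤ Ca * b k)
    (hA3c : ∃ B : ℝ, (∀ k, b k ≤ B) ∧ ∃ κ : ℝ, 0 < κ ∧ κ < 1 ∧
      B < min (κ / (2 * (N * βa + N * Real.sqrt N * βa + Ca * βH ^ 2)))
        ((1 - (1 - κ)⁻¹) * κ / (2 * N * Real.sqrt N * βa * (1 - (1 - κ) ^ (-(d + 1 : ℤ))))))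
    -- the matrices F(k) defined by the delay-elimination recursion
    (F : ℤ → Ω → Matrix (Fin N × Fin n) (Fin N × Fin n) ℝ)
    (hFinit : ∀ k : ℤ, -(d:ℤ) ≤ k → k ≤ -1 → ∀ ω, F k ω = 1)
    (hFrec : ∀ (k : ℕ) (ω : Ω), F k ω = 1 -
      (b k • (degMat (A k ω) ⊗ₖ (1 : Matrix (Fin n) (Fin n) ℝ))
        + a k • blockHtH (fun i => H k i ω)
        - b k • ∑ q ∈ Finset.range (d+1),
            delayAdj n (A k ω) (fun j i => lam k j i ω) q *
              (phiProdZ (fun t => F t ω) ((k:ℤ) - 1) ((k:ℤ) - q))⁻¹)) :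
    -- conclusion
    ∃ κ : ℝ, 0 < κ ∧ κ < 1 ∧ ∀ k : ℕ, ∀ᵐ ω ∂μ,
      IsUnit (F k ω) ∧ specNorm ((F k ω)⁻¹) ≤ (1 - κ)⁻¹ := by
  obtain ⟨B, hbB, κ, hκ0, hκ1, hB⟩ := hA3c
  refine ⟨κ, hκ0, hκ1, fun k => ?_⟩
  filter_upwards [hA2b] with ω ⟨hA, hH⟩
  induction k using Nat.strong_induction_on with
  | _ k ih =>
    refine Matrix.isUnit_and_l2_opNorm_inv_le hκ1 ?_
    rw [hFrec, sub_sub_cancel]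
    refine (norm_sub_delay_sum_le (hapos k).le (hbpos k).le hβa.le (hA k) (hH k)
      fun q hq => l2_opNorm_inv_phiProdZ_le fun t ht htk => ?_).trans
      (gain_bound hN (hapos k) (hbpos k) hβa hβH hκ0 hκ1 (hCa k) (hbB k) hB)
    rw [Finset.mem_range] at hq
    rcases lt_or_ge t 0 with h0 | h0
    · beta_reduce
      rw [hFinit t (by omega) (by omega) ω, inv_one]
      exact Matrix.l2_opNorm_one_le.trans ((one_le_inv₀ (by linarith)).2 (by linarith))
    · lift t to ℕ using h0
      exact (ih t (by omega)).2
end
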